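/- arXiv:2308.11383 — 2 statements merged into one kernel-verified Lean document; each statement's English description precedes it below -/
import Mathlib

section
/- Interpolation-type a priori estimate in non-divergence form (Proposition 6.3). Let s ∈ (0,1), β ∈ (0,2s) with β ≠ 1, and 0 < λ ≤ Λ. Then for any δ > 0 there exist C_δ and η_δ > 0, depending only on δ, n, s, β, λ, Λ, such that the following holds. Let (K_x)_{x∈ℝⁿ} be a family of symmetric Lévy measures, uniformly elliptic of order 2s with constants λ, Λ, satisfying: for all x, x' ∈ ℝⁿ, all ρ > 0, and every φ : ℝⁿ → ℝ with [φ]_{C^β(ℝⁿ)} ≤ 1 and φ(0) = 0, |∫_{B_{2ρ}∖B_ρ} φ d(K_x − K_{x'})| ≤ η_δ ρ^{β−2s}. Then [u]_{C^β(B_{1/2})} ≤ δ [u]_{C^β(ℝⁿ)} + C_δ (‖u‖_{L^∞(B₁)} + ‖f‖_{L^∞(B₁)}) for any compactly supported u ∈ C^{2s+ε'}(ℝⁿ) (for some ε' > 0) with L(u,x) = f(x) for every x ∈ B₁. -/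
open MeasureTheory Metric Set
open scoped ENNReal Topology RealInnerProductSpace

noncomputable section

abbrev Euc (n : ℕ) := EuclideanSpace ℝ (Fin n)

variable {n : ℕ}

def hDeg (σ : ℝ) : ℕ := ⌈σ⌉₊ - 1

def hSemiOn (σ : ℝ) (Ω A : Set (Euc n)) (u : Euc n → ℝ) : ℝ≥0∞ :=
  ⨆ (x : A) (y : A),
    ENNReal.ofReal
      (‖iteratedFDerivWithin ℝ (hDeg σ) u Ω ↑x - iteratedFDerivWithin ℝ (hDeg σ) u Ω ↑y‖ /
        ‖(x : Euc n) - (y : Euc n)‖ ^ (σ - (hDeg σ : ℝ)))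

def hSemi (σ : ℝ) (Ω : Set (Euc n)) (u : Euc n → ℝ) : ℝ≥0∞ := hSemiOn σ Ω Ω u

def hNormOn (σ : ℝ) (Ω A : Set (Euc n)) (u : Euc n → ℝ) : ℝ≥0∞ :=
  (∑ j ∈ Finset.range (hDeg σ + 1), ⨆ x : A, ENNReal.ofReal ‖iteratedFDerivWithin ℝ j u Ω ↑x‖) +
    hSemiOn σ Ω A u

def hNorm (σ : ℝ) (Ω : Set (Euc n)) (u : Euc n → ℝ) : ℝ≥0∞ := hNormOn σ Ω Ω u

def HolderMem (σ : ℝ) (Ω : Set (Euc n)) (u : Euc n → ℝ) : Prop :=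
  ContDiffOn ℝ (hDeg σ) u Ω ∧ hNorm σ Ω u ≠ ⊤

def HolderMemLoc (σ : ℝ) (Ω : Set (Euc n)) (u : Euc n → ℝ) : Prop :=
  ContDiffOn ℝ (hDeg σ) u Ω ∧
    ∀ A : Set (Euc n), IsCompact A → A ⊆ Ω → hNormOn σ Ω A u ≠ ⊤

def supNorm (Ω : Set (Euc n)) (u : Euc n → ℝ) : ℝ≥0∞ :=
  ⨆ x : Ω, ENNReal.ofReal |u ↑x|

def supNormW (τ : ℝ) (u : Euc n → ℝ) : ℝ≥0∞ :=
  ⨆ x : Euc n, ENNReal.ofReal (|u x| / (1 + ‖x‖ ^ τ))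

def IsLevyMeasure (K : Measure (Euc n)) : Prop :=
  K {0} = 0 ∧ (∫⁻ y, ENNReal.ofReal (min 1 (‖y‖ ^ 2)) ∂K) ≠ ⊤ ∧
    Measure.map (fun y => -y) K = K

def UnifElliptic (s lam Lam : ℝ) (K : Measure (Euc n)) : Prop :=
  (∀ r : ℝ, 0 < r →
    ENNReal.ofReal (r ^ (2 * s)) * K (ball 0 (2 * r) \ ball 0 r) ≤ ENNReal.ofReal Lam) ∧
  (∀ r : ℝ, 0 < r → ∀ e : Euc n, ‖e‖ = 1 →
    ENNReal.ofReal lam ≤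
      ENNReal.ofReal (r ^ (2 * s - 2)) * ∫⁻ y in ball 0 r, ENNReal.ofReal (⟪e, y⟫ ^ 2) ∂K)

def Lop (K : Euc n → Measure (Euc n)) (u : Euc n → ℝ) (x : Euc n) : ℝ :=
  (1 / 2) * ∫ y, (2 * u x - u (x + y) - u (x - y)) ∂(K x)

def LopTI (K : Measure (Euc n)) (u : Euc n → ℝ) (x : Euc n) : ℝ :=
  (1 / 2) * ∫ y, (2 * u x - u (x + y) - u (x - y)) ∂K

def SolvesPtwise (K : Euc n → Measure (Euc n)) (u f : Euc n → ℝ) (Ω : Set (Euc n)) : Prop :=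
  ∀ x ∈ Ω, Integrable (fun y => 2 * u x - u (x + y) - u (x - y)) (K x) ∧ Lop K u x = f x

def tvDiff (μ ν : Measure (Euc n)) (A : Set (Euc n)) : ℝ≥0∞ :=
  (μ.restrict A - ν.restrict A) Set.univ + (ν.restrict A - μ.restrict A) Set.univ

def kernelHolder (s θ : ℝ) (K : Measure (Euc n)) : ℝ≥0∞ :=
  ⨆ (ρ : ℝ) (_ : 0 < ρ) (x : Euc n) (x' : Euc n)
      (_ : x ∈ ball 0 (ρ / 2)) (_ : x' ∈ ball 0 (ρ / 2)) (_ : x ≠ x'),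
    ENNReal.ofReal (ρ ^ (2 * s + θ) / ‖x - x'‖ ^ θ) *
      tvDiff (Measure.map (fun y => x - y) K) (Measure.map (fun y => x' - y) K)
        (ball 0 (2 * ρ) \ ball 0 ρ)

def KantCond (s γ : ℝ) (μ ν : Measure (Euc n)) (c : ℝ) : Prop :=
  ∀ ρ : ℝ, 0 < ρ → ∀ φ : Euc n → ℝ, ContDiff ℝ (hDeg γ) φ →
    hSemi γ Set.univ φ ≤ 1 → φ 0 = 0 →
    |(∫ y in ball 0 (2 * ρ) \ ball 0 ρ, φ y ∂μ) -
        ∫ y in ball 0 (2 * ρ) \ ball 0 ρ, φ y ∂ν| ≤ c * ρ ^ (γ - 2 * s)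

/-- The symmetric second difference of `g` at `x` with increment `y`. -/
def sd (g : Euc n → ℝ) (x y : Euc n) : ℝ := g (x + y) + g (x - y) - 2 * g x

/-- Bounded continuous real functions. -/
def IsBC (g : Euc n → ℝ) : Prop := Continuous g ∧ ∃ C, ∀ x, |g x| ≤ C

/-- The average of the translates of `g` with respect to the measure `ν`. -/
def avg (ν : Measure (Euc n)) (g : Euc n → ℝ) (x : Euc n) : ℝ := ∫ y, g (x + y) ∂ν

/-- The carré du champ of the jump operator with jump measure `μ`. -/
def cdc (μ : Measure (Euc n)) (w : Euc n → ℝ) (x : Euc n) : ℝ := ∫ y, (w (x + y) - w x) ^ 2 ∂μ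

theorem IsBC.shift {g : Euc n → ℝ} (hg : IsBC g) (a : Euc n) : IsBC fun x => g (x + a) := by
  obtain ⟨hc, C, hC⟩ := hg
  exact ⟨by fun_prop, C, fun x => hC _⟩

theorem IsBC.add {g h : Euc n → ℝ} (hg : IsBC g) (hh : IsBC h) : IsBC fun x => g x + h x := by
  obtain ⟨hc, C, hC⟩ := hg
  obtain ⟨hc', C', hC'⟩ := hh
  exact ⟨by fun_prop, C + C', fun x => (abs_add_le _ _).trans (add_le_add (hC x) (hC' x))⟩

theorem IsBC.const_mul {g : Euc n → ℝ} (hg : IsBC g) (c : ℝ) : IsBC fun x => c * g x := by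
  obtain ⟨hc, C, hC⟩ := hg
  refine ⟨by fun_prop, |c| * C, fun x => ?_⟩
  rw [abs_mul]
  exact mul_le_mul_of_nonneg_left (hC x) (abs_nonneg c)

theorem IsBC.neg {g : Euc n → ℝ} (hg : IsBC g) : IsBC fun x => -g x := by
  simpa using hg.const_mul (-1)

theorem IsBC.sub {g h : Euc n → ℝ} (hg : IsBC g) (hh : IsBC h) : IsBC fun x => g x - h x := by
  simpa [sub_eq_add_neg] using hg.add hh.neg

theorem IsBC.sq {g : Euc n → ℝ} (hg : IsBC g) : IsBC fun x => g x ^ 2 := by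
  obtain ⟨hc, C, hC⟩ := hg
  refine ⟨by fun_prop, C ^ 2, fun x => ?_⟩
  rw [abs_pow]
  exact pow_le_pow_left₀ (abs_nonneg _) (hC x) 2

theorem IsBC.mul {g h : Euc n → ℝ} (hg : IsBC g) (hh : IsBC h) : IsBC fun x => g x * h x := by
  obtain ⟨hc, C, hC⟩ := hg
  obtain ⟨hc', C', hC'⟩ := hh
  refine ⟨by fun_prop, C * C', fun x => ?_⟩
  rw [abs_mul]
  exact mul_le_mul (hC x) (hC' x) (abs_nonneg _) ((abs_nonneg _).trans (hC x))

theorem IsBC.integrable {g : Euc n → ℝ} (hg : IsBC g) (ν : Measure (Euc n)) [IsFiniteMeasure ν] :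
    Integrable g ν := by
  obtain ⟨hc, C, hC⟩ := hg
  exact Integrable.of_bound hc.aestronglyMeasurable C (Filter.Eventually.of_forall hC)

theorem IsBC.translate {g : Euc n → ℝ} (hg : IsBC g) (x : Euc n) : IsBC fun y => g (x + y) := by
  simpa only [add_comm x] using hg.shift x

theorem IsBC.reflect {g : Euc n → ℝ} (hg : IsBC g) (x : Euc n) : IsBC fun y => g (x - y) := by
  obtain ⟨hc, C, hC⟩ := hg
  exact ⟨by fun_prop, C, fun x => hC _⟩

theorem IsBC.const (c : ℝ) : IsBC fun _ : Euc n => c := ⟨continuous_const, |c|, fun _ => le_rfl⟩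

theorem IsBC.sd {g : Euc n → ℝ} (hg : IsBC g) (x : Euc n) : IsBC (sd g x) :=
  ((hg.translate x).add (hg.reflect x)).sub (IsBC.const _)

theorem IsBC.avg {g : Euc n → ℝ} (hg : IsBC g) (ν : Measure (Euc n)) [IsFiniteMeasure ν] :
    IsBC (avg ν g) := by
  obtain ⟨hc, C, hC⟩ := hg
  refine ⟨?_, C * ν.real univ, fun x => ?_⟩
  · refine continuous_of_dominated (bound := fun _ => C) (fun x => ?_)
      (fun x => Filter.Eventually.of_forall fun y => hC _) (integrable_const C)
      (Filter.Eventually.of_forall fun y => by fun_prop)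
    exact (hc.comp (by fun_prop : Continuous fun y => x + y)).aestronglyMeasurable
  · exact norm_integral_le_of_norm_le_const (f := fun y => g (x + y))
      (Filter.Eventually.of_forall fun y => hC _)

theorem avg_comm {g : Euc n → ℝ} (hg : IsBC g) (μ ν : Measure (Euc n)) [IsFiniteMeasure μ]
    [IsFiniteMeasure ν] (x : Euc n) : avg μ (avg ν g) x = avg ν (avg μ g) x := by
  obtain ⟨hc, C, hC⟩ := hg
  simp only [avg]
  rw [integral_integral_swap]
  · simp only [add_right_comm]
  · refine Integrable.of_bound (Continuous.aestronglyMeasurable ?_) C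
      (Filter.Eventually.of_forall fun p => hC _)
    simp only [Function.uncurry_def]
    fun_prop

theorem avg_add {g h : Euc n → ℝ} (hg : IsBC g) (hh : IsBC h) (ν : Measure (Euc n))
    [IsFiniteMeasure ν] (x : Euc n) :
    avg ν (fun z => g z + h z) x = avg ν g x + avg ν h x :=
  integral_add ((hg.translate x).integrable ν) ((hh.translate x).integrable ν)

theorem avg_sub {g h : Euc n → ℝ} (hg : IsBC g) (hh : IsBC h) (ν : Measure (Euc n))
    [IsFiniteMeasure ν] (x : Euc n) :
    avg ν (fun z => g z - h z) x = avg ν g x - avg ν h x :=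
  integral_sub ((hg.translate x).integrable ν) ((hh.translate x).integrable ν)

theorem avg_const_mul (c : ℝ) (g : Euc n → ℝ) (ν : Measure (Euc n)) (x : Euc n) :
    avg ν (fun z => c * g z) x = c * avg ν g x :=
  integral_const_mul c _

theorem avg_shift (g : Euc n → ℝ) (ν : Measure (Euc n)) (a x : Euc n) :
    avg ν (fun z => g (z + a)) x = avg ν g (x + a) := by
  simp only [avg, add_right_comm]

theorem sd_avg {g : Euc n → ℝ} (hg : IsBC g) (ν : Measure (Euc n)) [IsFiniteMeasure ν]
    (x y : Euc n) : sd (avg ν g) x y = avg ν (fun z => sd g z y) x := by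
  have h1 := avg_add (hg.shift y) (hg.shift (-y)) ν x
  have h2 := avg_sub ((hg.shift y).add (hg.shift (-y))) (hg.const_mul 2) ν x
  rw [h1, avg_const_mul, avg_shift, avg_shift] at h2
  simp only [sd, sub_eq_add_neg] at h2 ⊢
  exact h2.symm

theorem IsBC.sd_left {g : Euc n → ℝ} (hg : IsBC g) (y : Euc n) : IsBC fun z => _root_.sd g z y := by
  have := ((hg.shift y).add (hg.shift (-y))).sub (hg.const_mul 2)
  simpa only [_root_.sd, sub_eq_add_neg] using this

theorem abs_avg_le {g : Euc n → ℝ} {C : ℝ} (hC : ∀ x, |g x| ≤ C) (ν : Measure (Euc n))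
    [IsProbabilityMeasure ν] (x : Euc n) : |avg ν g x| ≤ C := by
  simpa [avg] using norm_integral_le_of_norm_le_const (μ := ν) (f := fun y => g (x + y))
    (Filter.Eventually.of_forall fun y => hC _)

theorem abs_sd_avg_le {g : Euc n → ℝ} (hg : IsBC g) (ν : Measure (Euc n)) [IsProbabilityMeasure ν]
    {y : Euc n} {C : ℝ} (hC : ∀ z, |sd g z y| ≤ C) (x : Euc n) : |sd (avg ν g) x y| ≤ C := by
  rw [sd_avg hg]
  exact abs_avg_le hC ν x

theorem integral_sd_of_symm {μ : Measure (Euc n)} [IsFiniteMeasure μ]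
    (hμ : Measure.map (fun y => -y) μ = μ) {g : Euc n → ℝ} (hg : IsBC g) (x : Euc n) :
    ∫ y, sd g x y ∂μ = 2 * (avg μ g x - μ.real univ * g x) := by
  have h1 : ∫ y, g (x - y) ∂μ = avg μ g x := by
    conv_lhs => rw [← hμ]
    rw [integral_map (by fun_prop) ((hg.reflect x).1.aestronglyMeasurable)]
    simp [avg]
  have h2 : ∫ y, sd g x y ∂μ
      = (∫ y, g (x + y) ∂μ) + (∫ y, g (x - y) ∂μ) - ∫ _y, 2 * g x ∂μ := by
    rw [← integral_add ((hg.translate x).integrable μ) ((hg.reflect x).integrable μ),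
      ← integral_sub (((hg.translate x).add (hg.reflect x)).integrable μ) (integrable_const _)]
    rfl
  rw [h2, h1, integral_const, smul_eq_mul]
  simp only [avg]
  ring

/-- Convolution powers of a measure. -/
def convPow (μ : Measure (Euc n)) : ℕ → Measure (Euc n)
  | 0 => Measure.dirac 0
  | k + 1 => (μ.prod (convPow μ k)).map fun p => p.1 + p.2

instance isFiniteMeasure_convPow (μ : Measure (Euc n)) [IsFiniteMeasure μ] (k : ℕ) :
    IsFiniteMeasure (convPow μ k) := by
  induction k with
  | zero => unfold convPow; infer_instance
  | succ k ih => unfold convPow; infer_instance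

theorem avg_convPow_succ {μ : Measure (Euc n)} [IsFiniteMeasure μ] (k : ℕ) {g : Euc n → ℝ}
    (hg : IsBC g) (x : Euc n) : avg (convPow μ (k + 1)) g x = avg (convPow μ k) (avg μ g) x := by
  rw [← avg_comm hg]
  obtain ⟨hc, C, hC⟩ := hg
  simp only [avg, convPow]
  rw [integral_map (by fun_prop)
    (by exact (hc.comp (by fun_prop : Continuous fun y => x + y)).aestronglyMeasurable),
    integral_prod]
  · simp only [add_assoc]
  · refine Integrable.of_bound (Continuous.aestronglyMeasurable ?_) C
      (Filter.Eventually.of_forall fun p => hC _)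
    fun_prop

theorem convPow_univ (μ : Measure (Euc n)) [IsFiniteMeasure μ] (k : ℕ) :
    convPow μ k univ = μ univ ^ k := by
  induction k with
  | zero => simp [convPow]
  | succ k ih =>
    unfold convPow
    rw [Measure.map_apply (by fun_prop) MeasurableSet.univ, preimage_univ, ← univ_prod_univ,
      Measure.prod_prod, ih, pow_succ']

/-- The kernel of the resolvent `(1 + T A)⁻¹` of the jump operator `A` with jump measure `μ`. -/
def resKer (T : ℝ) (μ : Measure (Euc n)) : Measure (Euc n) :=
  Measure.sum fun k =>
    ENNReal.ofReal (T ^ k / (1 + T * μ.real univ) ^ (k + 1)) • convPow μ k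

theorem isProbabilityMeasure_resKer {T : ℝ} (hT : 0 ≤ T) (μ : Measure (Euc n)) [IsFiniteMeasure μ] :
    IsProbabilityMeasure (resKer T μ) := by
  constructor
  set κ := μ.real univ with hκ
  have hκ0 : 0 ≤ κ := measureReal_nonneg
  have hκE : μ univ = ENNReal.ofReal κ := (ofReal_measureReal).symm
  have hp : 0 < 1 + T * κ := by positivity
  have hq : T * κ / (1 + T * κ) < 1 := by rw [div_lt_one hp]; linarith
  have hq0 : 0 ≤ T * κ / (1 + T * κ) := by positivity
  rw [resKer, Measure.sum_apply _ MeasurableSet.univ]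
  have : ∀ k : ℕ, (ENNReal.ofReal (T ^ k / (1 + T * κ) ^ (k + 1)) • convPow μ k) univ
      = ENNReal.ofReal ((1 + T * κ)⁻¹ * (T * κ / (1 + T * κ)) ^ k) := by
    intro k
    rw [Measure.smul_apply, convPow_univ, hκE, ← ENNReal.ofReal_pow hκ0, smul_eq_mul,
      ← ENNReal.ofReal_mul (by positivity)]
    congr 1
    rw [div_pow, mul_pow, pow_succ]
    field_simp
  refine (tsum_congr this).trans ?_
  rw [← ENNReal.ofReal_tsum_of_nonneg (fun k => by positivity)
    ((summable_geometric_of_lt_one hq0 hq).mul_left _), tsum_mul_left,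
    tsum_geometric_of_lt_one hq0 hq]
  have : (1 + T * κ)⁻¹ * (1 - T * κ / (1 + T * κ))⁻¹ = 1 := by
    rw [one_sub_div hp.ne']
    field_simp
    ring
  rw [this, ENNReal.ofReal_one]

theorem resKer_identity {T : ℝ} (hT : 0 ≤ T) {μ : Measure (Euc n)} [IsFiniteMeasure μ]
    {g : Euc n → ℝ} (hg : IsBC g) (x : Euc n) :
    (1 + T * μ.real univ) * avg (resKer T μ) g x - T * avg (resKer T μ) (avg μ g) x = g x := by
  have := isProbabilityMeasure_resKer hT μ
  set κ := μ.real univ with hκ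
  have hκ0 : 0 ≤ κ := measureReal_nonneg
  have hp : 0 < 1 + T * κ := by positivity
  have key : ∀ {h : Euc n → ℝ}, IsBC h →
      HasSum (fun k : ℕ => T ^ k / (1 + T * κ) ^ (k + 1) * avg (convPow μ k) h x)
        (avg (resKer T μ) h x) := by
    intro h hh
    have h1 := hasSum_integral_measure (f := fun y => h (x + y))
      (μ := fun k : ℕ => ENNReal.ofReal (T ^ k / (1 + T * κ) ^ (k + 1)) • convPow μ k)
      ((hh.translate x).integrable (resKer T μ))
    simp only [integral_smul_measure, smul_eq_mul] at h1
    refine (congrArg (fun F => HasSum F _) (funext fun k => ?_)).mpr h1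
    rw [ENNReal.toReal_ofReal (by positivity), avg]
  have h1 := (key hg).mul_left (1 + T * κ)
  have h2 := (key (hg.avg μ)).mul_left T
  have h3 := (hasSum_nat_add_iff' 1).mpr h1
  have h4 : ∀ k : ℕ, (1 + T * κ) * (T ^ (k + 1) / (1 + T * κ) ^ (k + 1 + 1) *
      avg (convPow μ (k + 1)) g x) =
      T * (T ^ k / (1 + T * κ) ^ (k + 1) * avg (convPow μ k) (avg μ g) x) := by
    intro k
    rw [avg_convPow_succ k hg, pow_succ (1 + T * κ) (k + 1), pow_succ T k]
    field_simp
  simp only [h4] at h3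
  have h5 := h3.unique h2
  have h6 : avg (convPow μ 0) g x = g x := by simp [avg, convPow]
  simp only [Finset.range_one, Finset.sum_singleton, h6, pow_zero, zero_add, pow_one] at h5
  have h7 : (1 + T * κ) * (1 / (1 + T * κ) * g x) = g x := by field_simp
  linarith

theorem resKer_identity' {T : ℝ} (hT : 0 ≤ T) {μ : Measure (Euc n)} [IsFiniteMeasure μ]
    {g : Euc n → ℝ} (hg : IsBC g) (x : Euc n) :
    (1 + T * μ.real univ) * avg (resKer T μ) g x - T * avg μ (avg (resKer T μ) g) x = g x := by
  have := isProbabilityMeasure_resKer hT μ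
  rw [avg_comm hg, resKer_identity hT hg]

theorem cdc_eq {μ : Measure (Euc n)} [IsFiniteMeasure μ] {w : Euc n → ℝ} (hw : IsBC w)
    (x : Euc n) :
    cdc μ w x = avg μ (fun z => w z ^ 2) x - 2 * w x * avg μ w x + μ.real univ * w x ^ 2 := by
  have h1 : cdc μ w x = ∫ y, (w (x + y) ^ 2 - 2 * w x * w (x + y) + w x ^ 2) ∂μ := by
    unfold cdc
    congr 1
    ext y
    ring
  have i1 := (hw.sq.translate x)
  have i2 := (hw.translate x).const_mul (2 * w x)
  rw [h1, integral_add ((i1.sub i2).integrable μ) (integrable_const _),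
    integral_sub (i1.integrable μ) (i2.integrable μ), integral_const_mul, integral_const]
  rfl

theorem IsBC.cdc {w : Euc n → ℝ} (hw : IsBC w) (μ : Measure (Euc n)) [IsFiniteMeasure μ] :
    IsBC (cdc μ w) := by
  have h1 : _root_.cdc μ w = fun x => _root_.avg μ (fun z => w z ^ 2) x - 2 * (w x * _root_.avg μ w x)
      + μ.real univ * w x ^ 2 := by
    ext x
    rw [cdc_eq hw]
    ring
  rw [h1]
  exact ((hw.sq.avg μ).sub ((hw.mul (hw.avg μ)).const_mul 2)).add (hw.sq.const_mul _)

/-- Energy estimate for the resolvent. -/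
theorem avg_resKer_cdc_le {T : ℝ} (hT : 0 ≤ T) {μ : Measure (Euc n)} [IsFiniteMeasure μ]
    {g : Euc n → ℝ} (hg : IsBC g) (x : Euc n) :
    T * avg (resKer T μ) (cdc μ (avg (resKer T μ) g)) x
      ≤ avg (resKer T μ) (fun z => g z ^ 2) x := by
  have := isProbabilityMeasure_resKer hT μ
  set w := avg (resKer T μ) g with hwdef
  have hw : IsBC w := hg.avg _
  have h1 := resKer_identity hT (μ := μ) hw.sq x
  rw [← avg_const_mul, ← avg_const_mul, ← avg_sub (hw.sq.const_mul _) ((hw.sq.avg μ).const_mul _)]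
    at h1
  rw [← avg_const_mul]
  have h2 : (fun z => (1 + T * μ.real univ) * w z ^ 2 - T * avg μ (fun z => w z ^ 2) z)
      = fun z => g z ^ 2 - (g z - w z) ^ 2 - T * cdc μ w z := by
    ext z
    have h3 := resKer_identity' hT (μ := μ) hg z
    rw [← hwdef] at h3
    rw [cdc_eq hw, ← h3]
    ring
  rw [h2, avg_sub (hg.sq.sub (hg.sub hw).sq) ((hw.cdc μ).const_mul T),
    avg_sub hg.sq (hg.sub hw).sq] at h1
  have h3 : 0 ≤ avg (resKer T μ) (fun z => (g z - w z) ^ 2) x :=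
    integral_nonneg fun _ => sq_nonneg _
  nlinarith [sq_nonneg (w x)]

theorem sq_avg_le {g : Euc n → ℝ} (hg : IsBC g) (ν : Measure (Euc n)) [IsProbabilityMeasure ν]
    (x : Euc n) : avg ν g x ^ 2 ≤ avg ν (fun z => g z ^ 2) x := by
  have h := cdc_eq (μ := ν) (hg.sub (IsBC.const (avg ν g x))) x
  have h0 : 0 ≤ ∫ y, (g (x + y) - avg ν g x) ^ 2 ∂ν := integral_nonneg fun _ => sq_nonneg _
  have h1 : ∫ y, (g (x + y) - avg ν g x) ^ 2 ∂ν
      = ∫ y, (g (x + y) ^ 2 - 2 * avg ν g x * g (x + y) + avg ν g x ^ 2) ∂ν := by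
    congr 1
    ext y
    ring
  have i1 := (hg.sq.translate x)
  have i2 := (hg.translate x).const_mul (2 * avg ν g x)
  rw [h1, integral_add ((i1.sub i2).integrable ν) (integrable_const _),
    integral_sub (i1.integrable ν) (i2.integrable ν), integral_const_mul, integral_const] at h0
  simp only [probReal_univ, smul_eq_mul, one_mul] at h0
  simp only [avg] at h0 ⊢
  nlinarith

/-- Jensen's inequality for the carré du champ of an average. -/
theorem cdc_avg_le {w : Euc n → ℝ} (hw : IsBC w) (μ ν : Measure (Euc n)) [IsFiniteMeasure μ]
    [IsProbabilityMeasure ν] (x : Euc n) : cdc μ (avg ν w) x ≤ avg ν (cdc μ w) x := by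
  have hb : ∀ y, IsBC fun z => w (z + y) - w z := fun y => (hw.shift y).sub hw
  have h1 : ∀ y, (avg ν w (x + y) - avg ν w x) ^ 2
      ≤ avg ν (fun z => (w (z + y) - w z) ^ 2) x := by
    intro y
    have := sq_avg_le (hb y) ν x
    rwa [avg_sub (hw.shift y) hw, avg_shift] at this
  obtain ⟨hc, C, hC⟩ := hw
  have hint : Integrable (Function.uncurry fun y z => (w (x + z + y) - w (x + z)) ^ 2)
      (μ.prod ν) := by
    refine Integrable.of_bound (Continuous.aestronglyMeasurable ?_) ((C + C) ^ 2)
      (Filter.Eventually.of_forall fun p => ?_)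
    · simp only [Function.uncurry_def]
      fun_prop
    · simp only [Function.uncurry_def, Real.norm_eq_abs, abs_pow]
      exact pow_le_pow_left₀ (abs_nonneg _) ((abs_sub _ _).trans (add_le_add (hC _) (hC _))) 2
  have hw : IsBC w := ⟨hc, C, hC⟩
  have h2 : avg ν (cdc μ w) x = ∫ y, avg ν (fun z => (w (z + y) - w z) ^ 2) x ∂μ := by
    simp only [avg, cdc]
    rw [← integral_integral_swap hint]
  rw [h2]
  refine integral_mono ?_ ?_ h1
  · exact (((hw.avg ν).translate x).sub (IsBC.const _)).sq.integrable μ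
  · have := hint.integral_prod_left
    simp only [Function.uncurry_apply_pair] at this
    simpa only [avg, add_right_comm] using this

theorem cdc_resKer_resKer_le {T : ℝ} (hT : 0 < T) {μ : Measure (Euc n)} [IsFiniteMeasure μ]
    {g : Euc n → ℝ} (hg : IsBC g) (h1 : ∀ x, |g x| ≤ 1) (x : Euc n) :
    cdc μ (avg (resKer T μ) (avg (resKer T μ) g)) x ≤ 1 / T := by
  have := isProbabilityMeasure_resKer hT.le μ
  have h2 := avg_resKer_cdc_le hT.le (μ := μ) hg x
  have h3 := cdc_avg_le (hg.avg (resKer T μ)) μ (resKer T μ) x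
  have h4 : avg (resKer T μ) (fun z => g z ^ 2) x ≤ 1 := by
    refine (le_abs_self _).trans (abs_avg_le (fun z => ?_) _ _)
    rw [abs_pow]
    exact pow_le_one₀ (abs_nonneg _) (h1 z)
  rw [le_div_iff₀ hT]
  nlinarith

/-- The upper growth bound in the definition of uniform ellipticity. -/
def AnnulusBound (s Lam : ℝ) (K : Measure (Euc n)) : Prop :=
  ∀ r : ℝ, 0 < r →
    ENNReal.ofReal (r ^ (2 * s)) * K (ball 0 (2 * r) \ ball 0 r) ≤ ENNReal.ofReal Lam

theorem AnnulusBound.measure_le {s Lam r : ℝ} {K : Measure (Euc n)} (hK : AnnulusBound s Lam K)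
    (hr : 0 < r) : K (ball 0 (2 * r) \ ball 0 r) ≤ ENNReal.ofReal (Lam * r ^ (-(2 * s))) := by
  have hpos : 0 < r ^ (2 * s) := Real.rpow_pos_of_pos hr _
  rw [Real.rpow_neg hr.le, ← div_eq_mul_inv, ENNReal.ofReal_div_of_pos hpos,
    ENNReal.le_div_iff_mul_le (Or.inl (by simpa using hpos)) (Or.inl ENNReal.ofReal_ne_top),
    mul_comm (K _)]
  exact hK r hr

theorem AnnulusBound.lintegral_le {s Lam p r t : ℝ} {K : Measure (Euc n)}
    (hK : AnnulusBound s Lam K) (hK0 : K {0} = 0) (hLam : 0 ≤ Lam) (hp : 0 < p) (hr : 0 < r)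
    (ht : 0 < t) (htp : t ^ (p - 2 * s) < 1) {S : Set (Euc n)}
    (hS : S ⊆ {0} ∪ ⋃ k : ℕ, ball 0 (2 * (r * t ^ k)) \ ball 0 (r * t ^ k)) :
    ∫⁻ y in S, ENNReal.ofReal (‖y‖ ^ p) ∂K
      ≤ ENNReal.ofReal (2 ^ p * Lam * r ^ (p - 2 * s) / (1 - t ^ (p - 2 * s))) := by
  have hq0 : 0 ≤ t ^ (p - 2 * s) := (Real.rpow_pos_of_pos ht _).le
  have hk : ∀ k : ℕ, ∫⁻ y in ball 0 (2 * (r * t ^ k)) \ ball 0 (r * t ^ k),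
      ENNReal.ofReal (‖y‖ ^ p) ∂K
      ≤ ENNReal.ofReal (2 ^ p * Lam * r ^ (p - 2 * s) * (t ^ (p - 2 * s)) ^ k) := by
    intro k
    have hρ : 0 < r * t ^ k := by positivity
    calc ∫⁻ y in ball 0 (2 * (r * t ^ k)) \ ball 0 (r * t ^ k), ENNReal.ofReal (‖y‖ ^ p) ∂K
        ≤ ∫⁻ _ in ball 0 (2 * (r * t ^ k)) \ ball (0 : Euc n) (r * t ^ k),
            ENNReal.ofReal ((2 * (r * t ^ k)) ^ p) ∂K := by
          refine setLIntegral_mono' (measurableSet_ball.diff measurableSet_ball) fun y hy => ?_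
          refine ENNReal.ofReal_le_ofReal (Real.rpow_le_rpow (norm_nonneg _) ?_ hp.le)
          exact (mem_ball_zero_iff.mp hy.1).le
      _ = ENNReal.ofReal ((2 * (r * t ^ k)) ^ p) *
            K (ball 0 (2 * (r * t ^ k)) \ ball (0 : Euc n) (r * t ^ k)) := by
          rw [setLIntegral_const]
      _ ≤ ENNReal.ofReal ((2 * (r * t ^ k)) ^ p) *
            ENNReal.ofReal (Lam * (r * t ^ k) ^ (-(2 * s))) := by
          gcongr
          exact hK.measure_le hρ
      _ = _ := by
          rw [← ENNReal.ofReal_mul (by positivity)]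
          congr 1
          have e1 : (t ^ (p - 2 * s)) ^ k = (t ^ k) ^ (p - 2 * s) := by
            rw [← Real.rpow_natCast, ← Real.rpow_natCast, ← Real.rpow_mul ht.le,
              ← Real.rpow_mul ht.le, mul_comm]
          have e2 : (r * t ^ k) ^ (p - 2 * s)
              = (r * t ^ k) ^ p * (r * t ^ k) ^ (-(2 * s)) := by
            rw [← Real.rpow_add hρ, sub_eq_add_neg]
          rw [e1, mul_assoc, ← Real.mul_rpow hr.le (by positivity), e2,
            Real.mul_rpow (by norm_num) hρ.le]
          ring
  calc ∫⁻ y in S, ENNReal.ofReal (‖y‖ ^ p) ∂K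
      ≤ ∫⁻ y in {0} ∪ ⋃ k : ℕ, ball 0 (2 * (r * t ^ k)) \ ball 0 (r * t ^ k),
          ENNReal.ofReal (‖y‖ ^ p) ∂K := lintegral_mono_set hS
    _ ≤ (∫⁻ y in ({0} : Set (Euc n)), ENNReal.ofReal (‖y‖ ^ p) ∂K) +
        ∫⁻ y in ⋃ k : ℕ, ball 0 (2 * (r * t ^ k)) \ ball 0 (r * t ^ k),
          ENNReal.ofReal (‖y‖ ^ p) ∂K := lintegral_union_le _ _ _
    _ ≤ 0 + ∑' k : ℕ, ENNReal.ofReal (2 ^ p * Lam * r ^ (p - 2 * s) * (t ^ (p - 2 * s)) ^ k) := by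
        gcongr
        · rw [Measure.restrict_eq_zero.mpr hK0]
          simp
        · exact (lintegral_iUnion_le _ _).trans (ENNReal.tsum_le_tsum hk)
    _ = _ := by
        rw [zero_add, ← ENNReal.ofReal_tsum_of_nonneg (fun k => by positivity)
          ((summable_geometric_of_lt_one hq0 htp).mul_left _), tsum_mul_left,
          tsum_geometric_of_lt_one hq0 htp, div_eq_mul_inv]

theorem integrableOn_and_le_of_lintegral {K : Measure (Euc n)} {S : Set (Euc n)} {p B : ℝ}
    (hp : 0 ≤ p) (hB : 0 ≤ B)
    (h : ∫⁻ y in S, ENNReal.ofReal (‖y‖ ^ p) ∂K ≤ ENNReal.ofReal B) :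
    IntegrableOn (fun y => ‖y‖ ^ p) S K ∧ ∫ y in S, ‖y‖ ^ p ∂K ≤ B := by
  have hm : AEStronglyMeasurable (fun y : Euc n => ‖y‖ ^ p) (K.restrict S) :=
    (continuous_norm.rpow_const fun _ => Or.inr hp).aestronglyMeasurable
  have h0 : 0 ≤ᵐ[K.restrict S] fun y => ‖y‖ ^ p :=
    Filter.Eventually.of_forall fun y => by positivity
  refine ⟨(lintegral_ofReal_ne_top_iff_integrable hm h0).mp
    (h.trans_lt ENNReal.ofReal_lt_top).ne, ?_⟩
  rw [integral_eq_lintegral_of_nonneg_ae h0 hm]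
  exact ENNReal.toReal_le_of_le_ofReal hB h

theorem subset_iUnion_annuli_two {r : ℝ} (hr : 0 < r) :
    (ball (0 : Euc n) r)ᶜ ⊆ {0} ∪ ⋃ k : ℕ, ball 0 (2 * (r * 2 ^ k)) \ ball 0 (r * 2 ^ k) := by
  intro y hy
  rw [mem_compl_iff, mem_ball_zero_iff, not_lt] at hy
  obtain ⟨k, hk1, hk2⟩ := exists_nat_pow_near ((one_le_div hr).mpr hy) one_lt_two
  refine Or.inr (mem_iUnion.mpr ⟨k, ?_, ?_⟩)
  · rw [mem_ball_zero_iff]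
    rw [div_lt_iff₀ hr, pow_succ] at hk2
    linarith
  · rw [mem_ball_zero_iff, not_lt]
    rw [le_div_iff₀ hr] at hk1
    linarith

theorem subset_iUnion_annuli_half {r : ℝ} :
    ball (0 : Euc n) r ⊆
      {0} ∪ ⋃ k : ℕ, ball 0 (2 * (r / 2 * (1 / 2) ^ k)) \ ball 0 (r / 2 * (1 / 2) ^ k) := by
  intro y hy
  rw [mem_ball_zero_iff] at hy
  by_cases hy0 : y = 0
  · exact Or.inl hy0
  have hypos : 0 < ‖y‖ := norm_pos_iff.mpr hy0
  obtain ⟨k, hk1, hk2⟩ := exists_nat_pow_near ((one_le_div hypos).mpr hy.le) one_lt_two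
  rw [div_lt_iff₀ hypos, pow_succ] at hk2
  rw [le_div_iff₀ hypos] at hk1
  have h2 : (0 : ℝ) < 2 ^ k := by positivity
  rcases hk1.lt_or_eq with hk1 | hk1
  · refine Or.inr (mem_iUnion.mpr ⟨k, ?_, ?_⟩)
    · rw [mem_ball_zero_iff, one_div_pow]
      have : 2 * (r / 2 * (1 / 2 ^ k)) = r / 2 ^ k := by ring
      rw [this, lt_div_iff₀ h2]
      linarith
    · rw [mem_ball_zero_iff, not_lt, one_div_pow]
      have : r / 2 * (1 / 2 ^ k) = r / 2 / 2 ^ k := by ring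
      rw [this, div_le_iff₀ h2]
      linarith
  · obtain _ | k := k
    · simp at hk1
      linarith
    · refine Or.inr (mem_iUnion.mpr ⟨k, ?_, ?_⟩)
      · rw [mem_ball_zero_iff, one_div_pow]
        have h2 : (0 : ℝ) < 2 ^ k := by positivity
        have : 2 * (r / 2 * (1 / 2 ^ k)) = r / 2 ^ k := by ring
        rw [this, lt_div_iff₀ h2]
        rw [pow_succ] at hk1
        nlinarith
      · rw [mem_ball_zero_iff, not_lt, one_div_pow]
        have h2 : (0 : ℝ) < 2 ^ k := by positivity
        have : r / 2 * (1 / 2 ^ k) = r / 2 / 2 ^ k := by ring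
        rw [this, div_le_iff₀ h2]
        rw [pow_succ] at hk1
        linarith

theorem AnnulusBound.inner {s Lam r : ℝ} {K : Measure (Euc n)}
    (hK : AnnulusBound s Lam K) (hK0 : K {0} = 0) (hLam : 0 ≤ Lam) (hs : s < 1) (hr : 0 < r) :
    IntegrableOn (fun y => ‖y‖ ^ 2) (ball 0 r) K ∧ ∫ y in ball 0 r, ‖y‖ ^ 2 ∂K
      ≤ 4 * Lam / (1 - (1 / 2) ^ (2 - 2 * s)) * r ^ (2 - 2 * s) := by
  have hq : ((1 : ℝ) / 2) ^ (2 - 2 * s) < 1 :=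
    Real.rpow_lt_one (by norm_num) (by norm_num) (by linarith)
  have h1 := hK.lintegral_le hK0 hLam two_pos (half_pos hr) (by norm_num : (0 : ℝ) < 1 / 2) hq
    subset_iUnion_annuli_half
  have h2 : (2 : ℝ) ^ (2 : ℝ) * Lam * (r / 2) ^ (2 - 2 * s) / (1 - (1 / 2) ^ (2 - 2 * s))
      ≤ 4 * Lam / (1 - (1 / 2) ^ (2 - 2 * s)) * r ^ (2 - 2 * s) := by
    have h4 : (2 : ℝ) ^ (2 : ℝ) = 4 := by norm_num
    have : (r / 2) ^ (2 - 2 * s) ≤ r ^ (2 - 2 * s) :=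
      Real.rpow_le_rpow (by positivity) (by linarith) (by linarith)
    rw [h4, div_mul_eq_mul_div]
    have := sub_pos.mpr hq
    gcongr
  have h3 := integrableOn_and_le_of_lintegral two_pos.le
    (le_trans (div_nonneg (by positivity) (sub_pos.mpr hq).le) h2)
    (h1.trans (ENNReal.ofReal_le_ofReal h2))
  simpa only [Real.rpow_two] using h3

theorem AnnulusBound.outer {s Lam β r : ℝ} {K : Measure (Euc n)}
    (hK : AnnulusBound s Lam K) (hK0 : K {0} = 0) (hLam : 0 ≤ Lam) (hβ0 : 0 < β) (hβ : β < 2 * s)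
    (hr : 0 < r) :
    IntegrableOn (fun y => ‖y‖ ^ β) (ball 0 r)ᶜ K ∧ ∫ y in (ball 0 r)ᶜ, ‖y‖ ^ β ∂K
      ≤ 2 ^ β * Lam / (1 - 2 ^ (β - 2 * s)) * r ^ (β - 2 * s) := by
  have hq : (2 : ℝ) ^ (β - 2 * s) < 1 :=
    Real.rpow_lt_one_of_one_lt_of_neg (by norm_num) (by linarith)
  have h1 := hK.lintegral_le hK0 hLam hβ0 hr two_pos hq (subset_iUnion_annuli_two hr)
  have := sub_pos.mpr hq
  rw [div_mul_eq_mul_div]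
  exact integrableOn_and_le_of_lintegral hβ0.le (by positivity) h1

theorem AnnulusBound.measure_compl_ball_lt_top {s Lam β r : ℝ} {K : Measure (Euc n)}
    (hK : AnnulusBound s Lam K) (hK0 : K {0} = 0) (hLam : 0 ≤ Lam) (hβ0 : 0 < β) (hβ : β < 2 * s)
    (hr : 0 < r) : K (ball 0 r)ᶜ < ⊤ := by
  have h1 := (hK.outer hK0 hLam hβ0 hβ hr).1
  have h2 : IntegrableOn (fun _ => r ^ β) (ball (0 : Euc n) r)ᶜ K := by
    refine Integrable.mono' h1 aestronglyMeasurable_const ?_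
    refine (ae_restrict_mem measurableSet_ball.compl).mono fun y hy => ?_
    rw [mem_compl_iff, mem_ball_zero_iff, not_lt] at hy
    rw [Real.norm_of_nonneg (by positivity)]
    exact Real.rpow_le_rpow hr.le hy hβ0.le
  rw [integrableOn_const_iff (by simp)] at h2
  exact h2.resolve_left (by simpa using (Real.rpow_pos_of_pos hr _).ne')

theorem abs_setIntegral_sub_le_sum {μ ν : Measure (Euc n)} {g : Euc n → ℝ} {τ c e : ℝ} (hτ : 0 < τ)
    (hc : 0 ≤ c) (he : e ≤ 0) (hμ : IntegrableOn g (ball 0 τ)ᶜ μ)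
    (hν : IntegrableOn g (ball 0 τ)ᶜ ν)
    (h : ∀ ρ : ℝ, 0 < ρ → |(∫ y in ball 0 (2 * ρ) \ ball 0 ρ, g y ∂μ) -
      ∫ y in ball 0 (2 * ρ) \ ball 0 ρ, g y ∂ν| ≤ c * ρ ^ e) (N : ℕ) :
    |(∫ y in ball 0 (τ * 2 ^ N) \ ball 0 τ, g y ∂μ) -
      ∫ y in ball 0 (τ * 2 ^ N) \ ball 0 τ, g y ∂ν| ≤ c * (N * τ ^ e) := by
  induction N with
  | zero => simp
  | succ N ih =>
    have hN : τ ≤ τ * 2 ^ N := le_mul_of_one_le_right hτ.le (one_le_pow₀ one_le_two)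
    have hN0 : 0 < τ * 2 ^ N := by positivity
    have hsplit : ball (0 : Euc n) (τ * 2 ^ (N + 1)) \ ball 0 τ
        = (ball 0 (τ * 2 ^ N) \ ball 0 τ) ∪ (ball 0 (2 * (τ * 2 ^ N)) \ ball 0 (τ * 2 ^ N)) := by
      have e1 : τ * 2 ^ (N + 1) = 2 * (τ * 2 ^ N) := by ring
      rw [e1]
      ext y
      simp only [mem_sdiff, mem_ball_zero_iff, mem_union, not_lt]
      constructor
      · rintro ⟨h1, h2⟩
        rcases lt_or_ge ‖y‖ (τ * 2 ^ N) with h3 | h3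
        · exact Or.inl ⟨h3, h2⟩
        · exact Or.inr ⟨h1, h3⟩
      · rintro (⟨h1, h2⟩ | ⟨h1, h2⟩)
        · exact ⟨by linarith, h2⟩
        · exact ⟨h1, hN.trans h2⟩
    have hdisj : Disjoint (ball (0 : Euc n) (τ * 2 ^ N) \ ball 0 τ)
        (ball 0 (2 * (τ * 2 ^ N)) \ ball 0 (τ * 2 ^ N)) :=
      disjoint_left.mpr fun y h1 h2 => h2.2 h1.1
    have hm : MeasurableSet (ball (0 : Euc n) (2 * (τ * 2 ^ N)) \ ball 0 (τ * 2 ^ N)) :=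
      measurableSet_ball.diff measurableSet_ball
    have s1 : ball (0 : Euc n) (τ * 2 ^ N) \ ball 0 τ ⊆ (ball 0 τ)ᶜ := fun y hy => hy.2
    have s2 : ball (0 : Euc n) (2 * (τ * 2 ^ N)) \ ball 0 (τ * 2 ^ N) ⊆ (ball 0 τ)ᶜ :=
      fun y hy hy' => hy.2 (ball_subset_ball hN hy')
    rw [hsplit, setIntegral_union hdisj hm (hμ.mono_set s1) (hμ.mono_set s2),
      setIntegral_union hdisj hm (hν.mono_set s1) (hν.mono_set s2)]
    have h1 := h _ hN0
    have h2 : (τ * 2 ^ N) ^ e ≤ τ ^ e := Real.rpow_le_rpow_of_nonpos hτ hN he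
    have h3 : c * (τ * 2 ^ N) ^ e ≤ c * τ ^ e := mul_le_mul_of_nonneg_left h2 hc
    push_cast
    rw [abs_le] at ih h1 ⊢
    constructor <;> linarith [ih.1, ih.2, h1.1, h1.2]

theorem abs_sd_le_of_fderiv {g : Euc n → ℝ} {M α : ℝ} (hg : Differentiable ℝ g) (hα : 0 ≤ α)
    (hM : 0 ≤ M) (h : ∀ a b, ‖fderiv ℝ g a - fderiv ℝ g b‖ ≤ M * ‖a - b‖ ^ α) (x y : Euc n) :
    |sd g x y| ≤ M * (2 * ‖y‖) ^ α * ‖y‖ := by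
  have hd : ∀ v ∈ closedBall (0 : Euc n) ‖y‖, HasFDerivWithinAt (fun v => g (x + v) + g (x - v))
      (fderiv ℝ g (x + v) - fderiv ℝ g (x - v)) (closedBall 0 ‖y‖) v := by
    intro v _
    have h1 := (hg (x + v)).hasFDerivAt.comp v ((hasFDerivAt_id v).const_add x)
    have h2 := (hg (x - v)).hasFDerivAt.comp v ((hasFDerivAt_id v).const_sub x)
    have h3 := (h1.add h2).hasFDerivWithinAt (s := closedBall 0 ‖y‖)
    refine h3.congr_fderiv ?_
    ext w
    simp [sub_eq_add_neg]
  have hb : ∀ v ∈ closedBall (0 : Euc n) ‖y‖,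
      ‖fderiv ℝ g (x + v) - fderiv ℝ g (x - v)‖ ≤ M * (2 * ‖y‖) ^ α := by
    intro v hv
    rw [mem_closedBall_zero_iff] at hv
    refine (h _ _).trans ?_
    have e : x + v - (x - v) = (2 : ℝ) • v := by rw [two_smul]; abel
    rw [e, norm_smul, Real.norm_eq_abs, abs_two]
    gcongr
  have := (convex_closedBall (0 : Euc n) ‖y‖).norm_image_sub_le_of_norm_hasFDerivWithin_le hd hb
    (mem_closedBall_self (norm_nonneg y)) (by simp : y ∈ closedBall (0 : Euc n) ‖y‖)
  simp only [add_zero, sub_zero, Real.norm_eq_abs] at this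
  refine le_of_eq_of_le ?_ this
  unfold sd
  congr 1
  ring

theorem exists_sd_le_of_contDiff {ζ : Euc n → ℝ} (hζ : ContDiff ℝ 2 ζ) (hc : HasCompactSupport ζ) :
    ∃ C : ℝ, 0 ≤ C ∧ ∀ x y, |sd ζ x y| ≤ C * ‖y‖ ^ 2 := by
  obtain ⟨C, hC⟩ := (hζ.fderiv_right (m := 1) (by norm_num)).lipschitzWith_of_hasCompactSupport
    (hc.fderiv ℝ) one_ne_zero
  refine ⟨C * 2, by positivity, fun x y => ?_⟩
  have := abs_sd_le_of_fderiv (M := C) (α := 1) (hζ.differentiable two_ne_zero) zero_le_one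
    C.coe_nonneg (fun a b => by
      rw [Real.rpow_one, ← dist_eq_norm, ← dist_eq_norm]; exact hC.dist_le_mul a b) x y
  rw [Real.rpow_one] at this
  linarith

/-- The probability measure whose density is a normalized bump function. -/
def bumpMeasure (f : ContDiffBump (0 : Euc n)) : Measure (Euc n) :=
  volume.withDensity fun y => ENNReal.ofReal (f.normed volume y)

theorem integral_bumpMeasure (f : ContDiffBump (0 : Euc n)) (g : Euc n → ℝ) :
    ∫ y, g y ∂bumpMeasure f = ∫ y, f.normed volume y * g y := by
  rw [bumpMeasure, integral_withDensity_eq_integral_toReal_smul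
    (f.contDiff_normed (n := 0)).continuous.measurable.ennreal_ofReal
    (Filter.Eventually.of_forall fun _ => ENNReal.ofReal_lt_top)]
  simp [ENNReal.toReal_ofReal (f.nonneg_normed _)]

instance isProbabilityMeasure_bumpMeasure (f : ContDiffBump (0 : Euc n)) :
    IsProbabilityMeasure (bumpMeasure f) := by
  constructor
  rw [bumpMeasure, withDensity_apply _ MeasurableSet.univ, Measure.restrict_univ,
    ← ofReal_integral_eq_lintegral_ofReal f.integrable_normed
      (Filter.Eventually.of_forall fun y => f.nonneg_normed y), f.integral_normed,
    ENNReal.ofReal_one]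

theorem map_neg_bumpMeasure (f : ContDiffBump (0 : Euc n)) :
    Measure.map (fun y => -y) (bumpMeasure f) = bumpMeasure f := by
  ext S hS
  have hm : Measurable fun y : Euc n => -y := measurable_neg
  rw [Measure.map_apply hm hS, bumpMeasure, withDensity_apply _ (hm hS), withDensity_apply _ hS,
    ← lintegral_indicator (hm hS), ← lintegral_indicator hS, ← lintegral_neg_eq_self]
  congr 1
  ext y
  have h : -y ∈ (fun y : Euc n => -y) ⁻¹' S ↔ y ∈ S := by rw [mem_preimage, neg_neg]
  by_cases hy : y ∈ S
  · rw [indicator_of_mem (h.mpr hy), indicator_of_mem hy, f.normed_neg]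
  · rw [indicator_of_notMem (mt h.mp hy), indicator_of_notMem hy]

theorem differentiable_avg_bumpMeasure (f : ContDiffBump (0 : Euc n)) {w : Euc n → ℝ}
    (hw : IsBC w) : Differentiable ℝ (avg (bumpMeasure f) w) := by
  have h : avg (bumpMeasure f) w
      = convolution (f.normed volume) w (ContinuousLinearMap.lsmul ℝ ℝ) volume := by
    ext x
    rw [avg, integral_bumpMeasure, convolution]
    conv_lhs => rw [← integral_neg_eq_self]
    simp [f.normed_neg, sub_eq_add_neg]
  rw [h]
  exact (f.hasCompactSupport_normed.contDiff_convolution_left _ (n := 1) f.contDiff_normed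
    hw.1.locallyIntegrable).differentiable one_ne_zero

theorem sd_avg_bumpMeasure (f : ContDiffBump (0 : Euc n)) {w : Euc n → ℝ} (hw : IsBC w)
    (x y : Euc n) :
    sd (avg (bumpMeasure f) w) x y
      = 1 / 2 * ∫ z, sd (f.normed volume) z y * sd w x z := by
  set ζ := f.normed (volume : Measure (Euc n)) with hζdef
  have hζc : Continuous ζ := (f.contDiff_normed (n := 0)).continuous
  have hζi : Integrable ζ := f.integrable_normed
  obtain ⟨hwc, C, hC⟩ := hw
  have hint : ∀ (g : Euc n → ℝ), Integrable g → Integrable fun z => g z * w (x + z) :=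
    fun g hg => hg.mul_bdd (c := C) (by fun_prop) (Filter.Eventually.of_forall fun z => hC _)
  have hint' : ∀ (g : Euc n → ℝ), Integrable g → Integrable fun z => g z * w (x - z) :=
    fun g hg => hg.mul_bdd (c := C) (by fun_prop) (Filter.Eventually.of_forall fun z => hC _)
  have hθ : Integrable fun z => sd ζ z y :=
    ((hζi.comp_add_right y).add (hζi.comp_sub_right y)).sub (hζi.const_mul 2)
  have hA : ∀ v, avg (bumpMeasure f) w (x + v) = ∫ z, ζ (z - v) * w (x + z) := by
    intro v
    rw [avg, integral_bumpMeasure, ← integral_sub_right_eq_self _ v]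
    congr 1
    ext z
    congr 2
    abel
  have h1 : sd (avg (bumpMeasure f) w) x y = ∫ z, sd ζ z y * w (x + z) := by
    have a1 := hA y
    have a2 := hA (-y)
    have a3 := hA 0
    simp only [sub_neg_eq_add, sub_zero, add_zero, ← sub_eq_add_neg] at a2 a3
    unfold sd
    have i1 := hint _ (hζi.comp_sub_right y)
    have i2 := hint _ (hζi.comp_add_right y)
    have i3 : Integrable fun z => ζ (z - y) * w (x + z) + ζ (z + y) * w (x + z) := i1.add i2
    rw [a1, a2, a3, ← integral_const_mul, ← integral_add i1 i2,
      ← integral_sub i3 ((hint _ hζi).const_mul 2)]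
    congr 1
    ext z
    ring
  have heven : ∀ z, sd ζ (-z) y = sd ζ z y := by
    intro z
    have e1 : ζ (-z + y) = ζ (z - y) := by
      rw [hζdef, ← f.normed_neg]
      congr 1
      abel
    have e2 : ζ (-z - y) = ζ (z + y) := by
      rw [hζdef, ← f.normed_neg]
      congr 1
      abel
    have e3 : ζ (-z) = ζ z := f.normed_neg z
    simp only [sd, e1, e2, e3]
    ring
  have h2 : ∫ z, sd ζ z y * w (x - z) = ∫ z, sd ζ z y * w (x + z) := by
    rw [← integral_neg_eq_self]
    simp [heven]
  have h3 : ∫ z, sd ζ z y = 0 := by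
    have i1 : Integrable fun z => ζ (z + y) + ζ (z - y) :=
      (hζi.comp_add_right y).add (hζi.comp_sub_right y)
    unfold sd
    rw [integral_sub i1 (hζi.const_mul 2),
      integral_add (hζi.comp_add_right y) (hζi.comp_sub_right y), integral_add_right_eq_self,
      integral_sub_right_eq_self, integral_const_mul]
    ring
  have h4 : ∫ z, sd ζ z y * sd w x z
      = (∫ z, sd ζ z y * w (x + z)) + (∫ z, sd ζ z y * w (x - z)) - ∫ z, sd ζ z y * (2 * w x) := by
    have i1 : Integrable fun z => sd ζ z y * w (x + z) + sd ζ z y * w (x - z) :=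
      (hint _ hθ).add (hint' _ hθ)
    rw [← integral_add (hint _ hθ) (hint' _ hθ), ← integral_sub i1 (hθ.mul_const _)]
    congr 1
    ext z
    simp only [sd]
    ring
  rw [h4, h2, integral_mul_const, h3, h1]
  ring

/-- Mollification with second-difference estimates. -/
theorem exists_mollifier (n : ℕ) {β ε : ℝ} (hβ0 : 0 < β) (hβ2 : β < 2) (hε : 0 < ε) (hε1 : ε ≤ 1) :
    ∃ ν : Measure (Euc n), IsProbabilityMeasure ν ∧
      (∀ w, IsBC w → Differentiable ℝ (avg ν w)) ∧
      ∃ C : ℝ, 0 ≤ C ∧ ∀ w, IsBC w → (∀ x y, |sd w x y| ≤ ‖y‖ ^ β) →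
        (∀ x, |avg ν w x - w x| ≤ ε ^ β) ∧ ∀ x y, |sd (avg ν w) x y| ≤ C * ‖y‖ ^ 2 := by
  let f : ContDiffBump (0 : Euc n) := ⟨ε / 2, ε, half_pos hε, half_lt_self hε⟩
  have hsupp : ∀ z : Euc n, ε ≤ ‖z‖ → f.normed volume z = 0 := by
    intro z hz
    have : z ∉ Function.support (f.normed (volume : Measure (Euc n))) := by
      rw [f.support_normed_eq, mem_ball_zero_iff, not_lt]
      exact hz
    exact Function.notMem_support.mp this
  obtain ⟨C, hC0, hC⟩ := exists_sd_le_of_contDiff (f.contDiff_normed (μ := volume) (n := 2))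
    f.hasCompactSupport_normed
  set V := (volume : Measure (Euc n)).real (closedBall 0 2) with hV
  have hV0 : 0 ≤ V := measureReal_nonneg
  refine ⟨bumpMeasure f, inferInstance, fun w hw => differentiable_avg_bumpMeasure f hw,
    1 + 2 * C * V, by positivity, fun w hw hsd => ⟨fun x => ?_, fun x y => ?_⟩⟩
  · have h1 := integral_sd_of_symm (map_neg_bumpMeasure f) hw x
    rw [probReal_univ, one_mul, integral_bumpMeasure] at h1
    have h2 : ‖∫ y, f.normed volume y * sd w x y‖ ≤ ∫ y, f.normed volume y * ε ^ β := by
      refine norm_integral_le_of_norm_le (f.integrable_normed.mul_const _)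
        (Filter.Eventually.of_forall fun y => ?_)
      rw [norm_mul, Real.norm_of_nonneg (f.nonneg_normed y), Real.norm_eq_abs]
      rcases lt_or_ge ‖y‖ ε with hy | hy
      · have := f.nonneg_normed (μ := volume) y
        have := (hsd x y).trans (Real.rpow_le_rpow (norm_nonneg y) hy.le hβ0.le)
        gcongr
      · simp [hsupp y hy]
    rw [h1, integral_mul_const, f.integral_normed, one_mul, Real.norm_eq_abs, abs_mul, abs_two]
      at h2
    have := abs_nonneg (avg (bumpMeasure f) w x - w x)
    linarith
  · rcases le_or_gt ‖y‖ 1 with hy | hy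
    · have h2 : ‖∫ z, sd (f.normed volume) z y * sd w x z‖
          ≤ ∫ _z in closedBall (0 : Euc n) 2, C * ‖y‖ ^ 2 * 4 := by
        rw [← integral_indicator measurableSet_closedBall]
        refine norm_integral_le_of_norm_le ?_ (Filter.Eventually.of_forall fun z => ?_)
        · exact (integrable_indicator_iff measurableSet_closedBall).mpr
            (integrableOn_const (isCompact_closedBall _ _).measure_lt_top.ne)
        · by_cases hz : z ∈ closedBall (0 : Euc n) 2
          · rw [indicator_of_mem hz, norm_mul]
            rw [mem_closedBall_zero_iff] at hz
            refine mul_le_mul (hC z y) ((hsd x z).trans ?_) (norm_nonneg _) (by positivity)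
            calc ‖z‖ ^ β ≤ 2 ^ β := Real.rpow_le_rpow (norm_nonneg z) hz hβ0.le
              _ ≤ 2 ^ (2 : ℝ) := Real.rpow_le_rpow_of_exponent_le one_le_two hβ2.le
              _ = 4 := by norm_num
          · rw [indicator_of_notMem hz]
            rw [mem_closedBall_zero_iff, not_le] at hz
            have z1 : ε ≤ ‖z + y‖ := by
              have := norm_sub_le (z + y) y
              rw [add_sub_cancel_right] at this
              linarith
            have z2 : ε ≤ ‖z - y‖ := by
              have := norm_add_le (z - y) y
              rw [sub_add_cancel] at this
              linarith
            simp [sd, hsupp _ z1, hsupp _ z2, hsupp z (by linarith)]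
      rw [setIntegral_const, smul_eq_mul, ← hV] at h2
      rw [sd_avg_bumpMeasure f hw, abs_mul]
      rw [Real.norm_eq_abs] at h2
      rw [abs_of_pos (by norm_num : (0 : ℝ) < 1 / 2)]
      have := sq_nonneg ‖y‖
      nlinarith
    · refine (abs_sd_avg_le hw _ (fun z => hsd z y) x).trans ?_
      have h1 : ‖y‖ ^ β ≤ ‖y‖ ^ 2 := by
        rw [← Real.rpow_two]
        exact Real.rpow_le_rpow_of_exponent_le hy.le hβ2.le
      have : 0 ≤ C * V * ‖y‖ ^ 2 := by positivity
      nlinarith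

theorem sd_neg (g : Euc n → ℝ) (x y : Euc n) : sd (fun z => -g z) x y = -sd g x y := by
  simp only [sd]
  ring

/-- A quantitative viscosity inequality at the point `x`: whenever the bounded continuous function
`φ` has `C^{1,1}` constant `C` and `φ + q |· - x|² / 2` touches `u` from above at `x`
up to an affine function, the jump operator with jump measure `μ` is at most `E` on `φ`. -/
def ViscSub (μ : Measure (Euc n)) (u : Euc n → ℝ) (C q E : ℝ) (x : Euc n) : Prop :=
  ∀ φ, IsBC φ → (∀ y, |sd φ x y| ≤ C * ‖y‖ ^ 2) → (∀ y, sd u x y ≤ sd φ x y + q * ‖y‖ ^ 2) →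
    -(1 / 2 * ∫ y, sd φ x y ∂μ) ≤ E

theorem viscSub_of_integral {K K₀ : Measure (Euc n)} {u : Euc n → ℝ} {x : Euc n}
    {β τ R C q F a b c m : ℝ} (hu : IsBC u) (hβ : ∀ y, |sd u x y| ≤ ‖y‖ ^ β) (hτR : τ ≤ R)
    (hC : 0 ≤ C) (hq : 0 ≤ q) (hK₀ : K₀ (ball 0 τ)ᶜ < ⊤)
    (hint : Integrable (sd u x) K) (hF : -(1 / 2 * ∫ y, sd u x y ∂K) ≤ F)
    (hc : |(∫ y in ball 0 R \ ball 0 τ, sd u x y ∂K) -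
      ∫ y in ball 0 R \ ball 0 τ, sd u x y ∂K₀| ≤ c)
    (ha : IntegrableOn (fun y => ‖y‖ ^ 2) (ball 0 τ) K ∧ ∫ y in ball 0 τ, ‖y‖ ^ 2 ∂K ≤ a)
    (hb : IntegrableOn (fun y => ‖y‖ ^ β) (ball 0 R)ᶜ K ∧ ∫ y in (ball 0 R)ᶜ, ‖y‖ ^ β ∂K ≤ b)
    (hm : IntegrableOn (fun y => ‖y‖ ^ 2) (ball 0 R) K₀ ∧ ∫ y in ball 0 R, ‖y‖ ^ 2 ∂K₀ ≤ m) :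
    ViscSub (K₀.restrict (ball 0 R \ ball 0 τ)) u C q
      (F + 1 / 2 * ((C + q) * a + b + c + q * m)) x := by
  intro φ hφ hφC hle
  have hAc : ball (0 : Euc n) R \ ball 0 τ ⊆ (ball 0 τ)ᶜ := fun y hy => hy.2
  have : IsFiniteMeasure (K₀.restrict (ball 0 R \ ball 0 τ)) :=
    ⟨by rw [Measure.restrict_apply_univ]; exact (measure_mono hAc).trans_lt hK₀⟩
  have hsplit : ∫ y, sd u x y ∂K = (∫ y in ball 0 τ, sd u x y ∂K) +
      (∫ y in ball 0 R \ ball 0 τ, sd u x y ∂K) + ∫ y in (ball 0 R)ᶜ, sd u x y ∂K := by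
    rw [← integral_add_compl (measurableSet_ball (x := (0 : Euc n)) (ε := R)) hint]
    congr 1
    rw [← setIntegral_union disjoint_sdiff_right (measurableSet_ball.diff measurableSet_ball)
      hint.integrableOn hint.integrableOn, union_sdiff_cancel (ball_subset_ball hτR)]
  have h1 : ∫ y in ball 0 τ, sd u x y ∂K ≤ (C + q) * a := by
    calc ∫ y in ball 0 τ, sd u x y ∂K ≤ ∫ y in ball 0 τ, (C + q) * ‖y‖ ^ 2 ∂K := by
          refine setIntegral_mono hint.integrableOn (ha.1.const_mul _) fun y => ?_
          have := (abs_le.mp (hφC y)).2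
          linarith [hle y]
      _ ≤ _ := by
          rw [integral_const_mul]
          exact mul_le_mul_of_nonneg_left ha.2 (by positivity)
  have h2 : ∫ y in (ball 0 R)ᶜ, sd u x y ∂K ≤ b :=
    (setIntegral_mono hint.integrableOn hb.1 fun y => (abs_le.mp (hβ y)).2).trans hb.2
  have hA : IntegrableOn (fun y => ‖y‖ ^ 2) (ball 0 R \ ball 0 τ) K₀ := hm.1.mono_set sdiff_subset
  have h3 : ∫ y in ball 0 R \ ball 0 τ, sd u x y ∂K₀
      ≤ (∫ y in ball 0 R \ ball 0 τ, sd φ x y ∂K₀) + q * m := by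
    calc ∫ y in ball 0 R \ ball 0 τ, sd u x y ∂K₀
        ≤ ∫ y in ball 0 R \ ball 0 τ, (sd φ x y + q * ‖y‖ ^ 2) ∂K₀ :=
          integral_mono ((hu.sd x).integrable _) (((hφ.sd x).integrable _).add (hA.const_mul q)) hle
      _ = (∫ y in ball 0 R \ ball 0 τ, sd φ x y ∂K₀)
          + q * ∫ y in ball 0 R \ ball 0 τ, ‖y‖ ^ 2 ∂K₀ := by
          rw [integral_add ((hφ.sd x).integrable _) (hA.const_mul q), integral_const_mul]
      _ ≤ _ := by
          have := (setIntegral_mono_set hm.1 (Filter.Eventually.of_forall fun y => by positivity)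
            (sdiff_subset (t := ball 0 τ)).eventuallyLE).trans hm.2
          gcongr
  linarith [(abs_le.mp hc).2]

theorem le_of_viscSub {μ : Measure (Euc n)} {u φ g : Euc n → ℝ} {C C₀ E S T d : ℝ} {x₁ : Euc n}
    (hu : IsBC u) (hφ : IsBC φ) (hφC : ∀ x y, |sd φ x y| ≤ C * ‖y‖ ^ 2)
    (hC₀ : ∀ x, |u x - φ x| ≤ C₀) (hT : 0 ≤ T)
    (hres : ∀ x, φ x - g x = T * (1 / 2 * ∫ y, sd φ x y ∂μ)) (hd : 0 < d)
    (hsub : ∀ x ∈ closedBall x₁ d, ViscSub μ u C (4 * C₀ / d ^ 2) E x)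
    (hS : ∀ x ∈ closedBall x₁ d, u x - g x ≤ S) : u x₁ - φ x₁ ≤ S + T * E := by
  have hC₀0 : 0 ≤ C₀ := (abs_nonneg _).trans (hC₀ 0)
  set ψ : Euc n → ℝ := fun z => 2 * C₀ / d ^ 2 * ‖z - x₁‖ ^ 2 with hψ
  have hcont : Continuous fun z => u z - φ z - ψ z := by
    have := hu.1
    have := hφ.1
    fun_prop
  obtain ⟨x, hx, hmax⟩ := (isCompact_closedBall x₁ d).exists_isMaxOn
    ⟨x₁, mem_closedBall_self hd.le⟩ hcont.continuousOn
  have hψ0 : ψ x₁ = 0 := by simp [hψ]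
  have hψnn : ∀ z, 0 ≤ ψ z := fun z => by positivity
  have hx1 : u x₁ - φ x₁ - ψ x₁ ≤ u x - φ x - ψ x := hmax (mem_closedBall_self hd.le)
  have hglob : ∀ z, u z - φ z - ψ z ≤ u x - φ x - ψ x := by
    intro z
    by_cases hz : z ∈ closedBall x₁ d
    · exact hmax hz
    · rw [mem_closedBall, dist_eq_norm, not_le] at hz
      have h1 : 2 * C₀ ≤ ψ z := by
        have : d ^ 2 ≤ ‖z - x₁‖ ^ 2 := by gcongr
        calc 2 * C₀ = 2 * C₀ / d ^ 2 * d ^ 2 := by field_simp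
          _ ≤ ψ z := by simp only [hψ]; gcongr
      linarith [(abs_le.mp (hC₀ z)).2, (abs_le.mp (hC₀ x₁)).1]
  have hsdψ : ∀ y, sd ψ x y = 4 * C₀ / d ^ 2 * ‖y‖ ^ 2 := by
    intro y
    have e := parallelogram_law_with_norm ℝ (x - x₁) y
    have e1 : x + y - x₁ = x - x₁ + y := by abel
    have e2 : x - y - x₁ = x - x₁ - y := by abel
    simp only [sd, hψ, e1, e2]
    have e3 : ‖x - x₁ + y‖ ^ 2 + ‖x - x₁ - y‖ ^ 2 - 2 * ‖x - x₁‖ ^ 2 = 2 * ‖y‖ ^ 2 := by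
      linarith
    linear_combination (2 * C₀ / d ^ 2) * e3
  have hle : ∀ y, sd u x y ≤ sd φ x y + 4 * C₀ / d ^ 2 * ‖y‖ ^ 2 := by
    intro y
    rw [← hsdψ]
    simp only [sd]
    linarith [hglob (x + y), hglob (x - y)]
  have h1 := hsub x hx φ hφ (hφC x) hle
  have h2 := mul_le_mul_of_nonneg_left h1 hT
  linarith [hres x, hS x hx, hψnn x]

theorem avg_resKer_sub {T : ℝ} (hT : 0 ≤ T) {μ : Measure (Euc n)} [IsFiniteMeasure μ]
    (hμ : Measure.map (fun y => -y) μ = μ) {g : Euc n → ℝ} (hg : IsBC g) (x : Euc n) :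
    avg (resKer T μ) g x - g x = T * (1 / 2 * ∫ y, sd (avg (resKer T μ) g) x y ∂μ) := by
  have := isProbabilityMeasure_resKer hT μ
  rw [integral_sd_of_symm hμ (hg.avg _)]
  linarith [resKer_identity' hT (μ := μ) hg x]

theorem abs_avg_resKer_sub_le {T β B : ℝ} (hT : 0 ≤ T) {μ : Measure (Euc n)} [IsFiniteMeasure μ]
    (hμ : Measure.map (fun y => -y) μ = μ) {g : Euc n → ℝ} (hg : IsBC g)
    (hβ : ∀ x y, |sd g x y| ≤ ‖y‖ ^ β)
    (hB : Integrable (fun y => ‖y‖ ^ β) μ ∧ ∫ y, ‖y‖ ^ β ∂μ ≤ B) (x : Euc n) :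
    |avg (resKer T μ) g x - g x| ≤ T * B := by
  have := isProbabilityMeasure_resKer hT μ
  rw [avg_resKer_sub hT hμ hg, abs_mul, abs_of_nonneg hT, abs_mul,
    abs_of_pos (by norm_num : (0 : ℝ) < 1 / 2)]
  have h := norm_integral_le_of_norm_le (f := sd (avg (resKer T μ) g) x) hB.1
    (Filter.Eventually.of_forall fun y => abs_sd_avg_le hg _ (fun z => hβ z y) x)
  rw [Real.norm_eq_abs] at h
  have := abs_nonneg (∫ y, sd (avg (resKer T μ) g) x y ∂μ)
  gcongr
  linarith [h.trans hB.2]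

/-- Comparison of a solution with the twice iterated resolvent of an approximation. -/
theorem abs_sub_resKer_resKer_le {μ : Measure (Euc n)} [IsFiniteMeasure μ]
    (hμ : Measure.map (fun y => -y) μ = μ) {u w : Euc n → ℝ} {β B C E S T d : ℝ}
    (hu : IsBC u) (hw : IsBC w) (hβ : ∀ x y, |sd w x y| ≤ ‖y‖ ^ β)
    (hC : ∀ x y, |sd w x y| ≤ C * ‖y‖ ^ 2) (hS : ∀ x, |w x - u x| ≤ S) (hT : 0 ≤ T)
    (hB : Integrable (fun y => ‖y‖ ^ β) μ ∧ ∫ y, ‖y‖ ^ β ∂μ ≤ B) (hd : 0 < d)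
    (hsub : ∀ x ∈ closedBall 0 (1 + 2 * d), ViscSub μ u C (4 * (S + 2 * (T * B)) / d ^ 2) E x)
    (hsub' : ∀ x ∈ closedBall 0 (1 + 2 * d),
      ViscSub μ (fun z => -u z) C (4 * (S + 2 * (T * B)) / d ^ 2) E x)
    {x : Euc n} (hx : x ∈ closedBall 0 1) :
    |u x - avg (resKer T μ) (avg (resKer T μ) w) x| ≤ S + 2 * (T * E) := by
  have := isProbabilityMeasure_resKer hT μ
  have hB0 : 0 ≤ T * B :=
    mul_nonneg hT ((integral_nonneg fun y => by positivity).trans hB.2)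
  have key : ∀ {v g : Euc n → ℝ} {S' : ℝ} {r : ℝ}, IsBC v → IsBC g →
      (∀ x y, |sd g x y| ≤ C * ‖y‖ ^ 2) →
      (∀ x, |v x - avg (resKer T μ) g x| ≤ S + 2 * (T * B)) →
      r + d ≤ 1 + 2 * d →
      (∀ x ∈ closedBall 0 (1 + 2 * d),
        ViscSub μ v C (4 * (S + 2 * (T * B)) / d ^ 2) E x) →
      (∀ x ∈ closedBall 0 (r + d), v x - g x ≤ S') →
      ∀ x ∈ closedBall 0 r, v x - avg (resKer T μ) g x ≤ S' + T * E := by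
    intro v g S' r hv hg hgC hvg hr hvisc hS' x hx
    have hsubset : closedBall x d ⊆ closedBall 0 (r + d) := by
      refine closedBall_subset_closedBall' ?_
      rw [mem_closedBall] at hx
      linarith
    exact le_of_viscSub hv (hg.avg _) (fun x y => abs_sd_avg_le hg _ (fun z => hgC z y) x) hvg hT
      (avg_resKer_sub hT hμ hg) hd
      (fun z hz => hvisc z (closedBall_subset_closedBall hr (hsubset hz)))
      fun z hz => hS' z (hsubset hz)
  set W := avg (resKer T μ) w with hW
  have hWbc : IsBC W := hw.avg _
  have hWβ : ∀ x y, |sd W x y| ≤ ‖y‖ ^ β := fun x y => abs_sd_avg_le hw _ (fun z => hβ z y) x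
  have hWC : ∀ x y, |sd W x y| ≤ C * ‖y‖ ^ 2 := fun x y => abs_sd_avg_le hw _ (fun z => hC z y) x
  have d1 := abs_avg_resKer_sub_le hT hμ hw hβ hB
  have d2 := abs_avg_resKer_sub_le hT hμ hWbc hWβ hB
  rw [← hW] at d1
  have b1 : ∀ x, |u x - W x| ≤ S + 2 * (T * B) := fun x => by
    have h1 := abs_le.mp (d1 x)
    have h2 := abs_le.mp (hS x)
    exact abs_le.mpr ⟨by linarith, by linarith⟩
  have b2 : ∀ x, |u x - avg (resKer T μ) W x| ≤ S + 2 * (T * B) := fun x => by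
    have h1 := abs_le.mp (d1 x)
    have h2 := abs_le.mp (hS x)
    have h3 := abs_le.mp (d2 x)
    exact abs_le.mpr ⟨by linarith, by linarith⟩
  have up1 := key (r := 1 + d) hu hw hC b1 (by linarith) hsub
    (S' := S) (fun z _ => by linarith [(abs_le.mp (hS z)).1])
  have up2 := key (r := 1) hu hWbc hWC b2 (by linarith) hsub up1 x hx
  have negavg : ∀ (g : Euc n → ℝ) z, avg (resKer T μ) (fun z => -g z) z = -avg (resKer T μ) g z :=
    fun g z => integral_neg _
  have lo1 := key (v := fun z => -u z) (g := fun z => -w z) (r := 1 + d) hu.neg hw.neg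
    (fun x y => by rw [sd_neg, abs_neg]; exact hC x y)
    (fun x => by rw [negavg, ← hW, neg_sub_neg, abs_sub_comm]; exact b1 x) (by linarith) hsub'
    (S' := S) (fun z _ => by linarith [(abs_le.mp (hS z)).2])
  simp only [negavg, ← hW] at lo1
  have lo2 := key (v := fun z => -u z) (g := fun z => -W z) (r := 1) hu.neg hWbc.neg
    (fun x y => by rw [sd_neg, abs_neg]; exact hWC x y)
    (fun x => by rw [negavg, neg_sub_neg, abs_sub_comm]; exact b2 x) (by linarith) hsub'
    lo1 x hx
  rw [negavg] at lo2
  exact abs_le.mpr ⟨by linarith, by linarith⟩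

theorem abs_taylor_le_of_sd {g : Euc n → ℝ} {C : ℝ} {x : Euc n}
    (hg : DifferentiableAt ℝ g x) (hC : ∀ z y, |sd g z y| ≤ C * ‖y‖ ^ 2) (y : Euc n) :
    |g (x + y) - g x - fderiv ℝ g x y| ≤ C * ‖y‖ ^ 2 := by
  set e : Euc n → ℝ := fun y => g (x + y) - g x - fderiv ℝ g x y with he
  have hC0 : 0 ≤ C * ‖y‖ ^ 2 := (abs_nonneg _).trans (hC x y)
  have step : ∀ v, |e v - 2 * e ((1 / 2 : ℝ) • v)| ≤ C * ‖(1 / 2 : ℝ) • v‖ ^ 2 := by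
    intro v
    have h1 := hC (x + (1 / 2 : ℝ) • v) ((1 / 2 : ℝ) • v)
    have e1 : x + (1 / 2 : ℝ) • v + (1 / 2 : ℝ) • v = x + v := by
      rw [add_assoc, ← add_smul]; norm_num
    simp only [sd, e1, add_sub_cancel_right] at h1
    refine le_of_eq_of_le ?_ h1
    simp only [he, map_smul, smul_eq_mul]
    congr 1
    ring
  have ind : ∀ k : ℕ, |e y| ≤ 2 ^ k * |e ((1 / 2 : ℝ) ^ k • y)|
      + (1 - (1 / 2) ^ k) * (C * ‖y‖ ^ 2) := by
    intro k
    induction k with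
    | zero => simp
    | succ k ih =>
      have h1 := step ((1 / 2 : ℝ) ^ k • y)
      rw [smul_smul, ← pow_succ', norm_smul, Real.norm_of_nonneg (by positivity)] at h1
      have h2 : |e ((1 / 2 : ℝ) ^ k • y)| ≤ 2 * |e ((1 / 2 : ℝ) ^ (k + 1) • y)|
          + C * ((1 / 2) ^ (k + 1) * ‖y‖) ^ 2 := by
        have := abs_sub_abs_le_abs_sub (e ((1 / 2 : ℝ) ^ k • y))
          (2 * e ((1 / 2 : ℝ) ^ (k + 1) • y))
        rw [abs_mul, abs_two] at this
        linarith
      have h3 : (2 : ℝ) ^ k * (C * ((1 / 2) ^ (k + 1) * ‖y‖) ^ 2)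
          = (1 / 2) ^ k * (1 / 4) * (C * ‖y‖ ^ 2) := by
        have : (2 : ℝ) ^ k * (1 / 2) ^ k = 1 := by rw [← mul_pow]; norm_num
        rw [pow_succ (1 / 2 : ℝ) k]
        linear_combination (1 / 2) ^ k * (1 / 4) * (C * ‖y‖ ^ 2) * this
      have h4 := mul_le_mul_of_nonneg_left h2 (by positivity : (0 : ℝ) ≤ 2 ^ k)
      have h5 : 0 ≤ (1 / 2 : ℝ) ^ k * (C * ‖y‖ ^ 2) := by positivity
      rw [pow_succ (2 : ℝ) k, pow_succ (1 / 2 : ℝ) k] at *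
      linarith
  refine le_of_forall_pos_le_add fun η hη => ?_
  obtain ⟨r, hr, hsmall⟩ : ∃ r > 0, ∀ v : Euc n, ‖v‖ < r → |e v| ≤ η / (‖y‖ + 1) * ‖v‖ := by
    have h1 := (hasFDerivAt_iff_isLittleO_nhds_zero.mp hg.hasFDerivAt).def
      (by positivity : 0 < η / (‖y‖ + 1))
    obtain ⟨r, hr, h2⟩ := Metric.eventually_nhds_iff.mp h1
    exact ⟨r, hr, fun v hv => h2 (by simpa using hv)⟩
  obtain ⟨k, hk⟩ := exists_pow_lt_of_lt_one (div_pos hr (by positivity : 0 < ‖y‖ + 1))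
    (by norm_num : (1 / 2 : ℝ) < 1)
  rw [lt_div_iff₀ (by positivity)] at hk
  have hv : ‖(1 / 2 : ℝ) ^ k • y‖ = (1 / 2) ^ k * ‖y‖ := by
    rw [norm_smul, Real.norm_of_nonneg (by positivity)]
  have hp : (0 : ℝ) < (1 / 2) ^ k := by positivity
  have h1 := hsmall ((1 / 2 : ℝ) ^ k • y) (by rw [hv]; nlinarith)
  rw [hv] at h1
  have h2 : (2 : ℝ) ^ k * (1 / 2) ^ k = 1 := by rw [← mul_pow]; norm_num
  have h3 : 2 ^ k * |e ((1 / 2 : ℝ) ^ k • y)| ≤ η := by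
    calc 2 ^ k * |e ((1 / 2 : ℝ) ^ k • y)| ≤ 2 ^ k * (η / (‖y‖ + 1) * ((1 / 2) ^ k * ‖y‖)) := by
          gcongr
      _ = η * (‖y‖ / (‖y‖ + 1)) := by linear_combination η / (‖y‖ + 1) * ‖y‖ * h2
      _ ≤ η * 1 := by
          gcongr
          rw [div_le_one (by positivity)]
          linarith
      _ = η := mul_one η
  have h4 := ind k
  have h5 : (1 - (1 / 2 : ℝ) ^ k) * (C * ‖y‖ ^ 2) ≤ 1 * (C * ‖y‖ ^ 2) := by
    gcongr
    linarith
  linarith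

theorem UnifElliptic.le_integral_inner {s lam Lam r : ℝ} {K : Measure (Euc n)}
    (hK : UnifElliptic s lam Lam K) (hr : 0 < r)
    (hint : IntegrableOn (fun y => ‖y‖ ^ 2) (ball 0 r) K) (v : Euc n) :
    IntegrableOn (fun y => ⟪v, y⟫ ^ 2) (ball 0 r) K ∧
      ‖v‖ ^ 2 * (lam * r ^ (2 - 2 * s)) ≤ ∫ y in ball 0 r, ⟪v, y⟫ ^ 2 ∂K := by
  have hI : ∀ v : Euc n, IntegrableOn (fun y => ⟪v, y⟫ ^ 2) (ball 0 r) K := by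
    intro v
    refine (hint.const_mul (‖v‖ ^ 2)).mono' (by fun_prop)
      (Filter.Eventually.of_forall fun y => ?_)
    rw [Real.norm_eq_abs, abs_pow, ← mul_pow]
    exact pow_le_pow_left₀ (abs_nonneg _) (abs_real_inner_le_norm v y) 2
  refine ⟨hI v, ?_⟩
  rcases eq_or_ne v 0 with rfl | hv
  · simp
  have hv' : 0 < ‖v‖ := norm_pos_iff.mpr hv
  have hunit : ‖(‖v‖⁻¹ : ℝ) • v‖ = 1 := by
    rw [norm_smul, norm_inv, norm_norm, inv_mul_cancel₀ hv'.ne']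
  have h1 := hK.2 r hr _ hunit
  rw [← ofReal_integral_eq_lintegral_ofReal (hI _)
    (Filter.Eventually.of_forall fun y => sq_nonneg _), ← ENNReal.ofReal_mul (by positivity),
    ENNReal.ofReal_le_ofReal_iff
      (mul_nonneg (by positivity) (integral_nonneg fun y => sq_nonneg _))] at h1
  simp only [real_inner_smul_left, mul_pow, integral_const_mul] at h1
  have e1 : r ^ (2 - 2 * s) * r ^ (2 * s - 2) = 1 := by
    rw [← Real.rpow_add hr]
    simp
  have e2 : ‖v‖ ^ 2 * ‖v‖⁻¹ ^ 2 = 1 := by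
    rw [← mul_pow, mul_inv_cancel₀ hv'.ne', one_pow]
  have h2 := mul_le_mul_of_nonneg_left h1
    (by positivity : 0 ≤ ‖v‖ ^ 2 * r ^ (2 - 2 * s))
  set I := ∫ y in ball 0 r, ⟪v, y⟫ ^ 2 ∂K
  have e3 : ‖v‖ ^ 2 * r ^ (2 - 2 * s) * (r ^ (2 * s - 2) * (‖v‖⁻¹ ^ 2 * I)) = I := by
    linear_combination (‖v‖ ^ 2 * ‖v‖⁻¹ ^ 2 * I) * e1 + I * e2
  linarith

/-- A carré du champ bound controls the gradient at scales where the quadratic error is small. -/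
theorem sq_norm_gradient_le {s lam Lam τ ρ R C D P p : ℝ} {K : Measure (Euc n)}
    (hK : UnifElliptic s lam Lam K) (hKτ : K (ball 0 τ)ᶜ < ⊤) {g : Euc n → ℝ} {x v : Euc n}
    (hg : IsBC g) (hv : ∀ y, |g (x + y) - g x - ⟪v, y⟫| ≤ C * ‖y‖ ^ 2) (hτρ : τ ≤ ρ)
    (hρR : ρ ≤ R) (hρ : 0 < ρ)
    (hP : IntegrableOn (fun y => ‖y‖ ^ 2) (ball 0 ρ) K ∧ ∫ y in ball 0 ρ, ‖y‖ ^ 2 ∂K ≤ P)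
    (hp : ∫ y in ball 0 τ, ‖y‖ ^ 2 ∂K ≤ p)
    (hD : cdc (K.restrict (ball 0 R \ ball 0 τ)) g x ≤ D) :
    ‖v‖ ^ 2 * (lam * ρ ^ (2 - 2 * s) - p) ≤ 2 * D + 2 * (C ^ 2 * ρ ^ 2 * P) := by
  obtain ⟨hI, hlow⟩ := hK.le_integral_inner hρ hP.1 v
  have hmeas : MeasurableSet (ball (0 : Euc n) ρ \ ball 0 τ) :=
    measurableSet_ball.diff measurableSet_ball
  have : IsFiniteMeasure (K.restrict (ball 0 R \ ball 0 τ)) :=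
    ⟨by rw [Measure.restrict_apply_univ]; exact (measure_mono fun y hy => hy.2).trans_lt hKτ⟩
  have hsq : IntegrableOn (fun y => (g (x + y) - g x) ^ 2) (ball 0 R \ ball 0 τ) K :=
    ((hg.translate x).sub (IsBC.const _)).sq.integrable _
  have hsub : ball (0 : Euc n) ρ \ ball 0 τ ⊆ ball 0 R \ ball 0 τ :=
    sdiff_subset_sdiff_left (ball_subset_ball hρR)
  have h1 : ∫ y in ball 0 ρ \ ball 0 τ, (g (x + y) - g x) ^ 2 ∂K ≤ D :=
    (setIntegral_mono_set hsq (Filter.Eventually.of_forall fun y => sq_nonneg _)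
      hsub.eventuallyLE).trans hD
  have hPA : IntegrableOn (fun y => ‖y‖ ^ 2) (ball 0 ρ \ ball 0 τ) K := hP.1.mono_set sdiff_subset
  have h2 : ∫ y in ball 0 ρ \ ball 0 τ, ‖y‖ ^ 2 ∂K ≤ P :=
    (setIntegral_mono_set hP.1 (Filter.Eventually.of_forall fun y => by positivity)
      sdiff_subset.eventuallyLE).trans hP.2
  have h3 : ∫ y in ball 0 ρ \ ball 0 τ, ⟪v, y⟫ ^ 2 ∂K
      ≤ 2 * D + 2 * (C ^ 2 * ρ ^ 2 * P) := by
    calc ∫ y in ball 0 ρ \ ball 0 τ, ⟪v, y⟫ ^ 2 ∂K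
        ≤ ∫ y in ball 0 ρ \ ball 0 τ,
            (2 * (g (x + y) - g x) ^ 2 + 2 * (C ^ 2 * ρ ^ 2) * ‖y‖ ^ 2) ∂K := by
          refine setIntegral_mono_on (hI.mono_set sdiff_subset)
            (((hsq.mono_set hsub).const_mul 2).add (hPA.const_mul _)) hmeas fun y hy => ?_
          have a1 := hv y
          have a2 : ‖y‖ < ρ := mem_ball_zero_iff.mp hy.1
          have a3 : (g (x + y) - g x - ⟪v, y⟫) ^ 2 ≤ C ^ 2 * ρ ^ 2 * ‖y‖ ^ 2 := by
            rw [← sq_abs]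
            calc |g (x + y) - g x - ⟪v, y⟫| ^ 2 ≤ (C * ‖y‖ ^ 2) ^ 2 := by gcongr
              _ = C ^ 2 * ‖y‖ ^ 2 * ‖y‖ ^ 2 := by ring
              _ ≤ _ := by gcongr
          nlinarith [sq_nonneg (2 * (g (x + y) - g x) - ⟪v, y⟫)]
      _ = 2 * (∫ y in ball 0 ρ \ ball 0 τ, (g (x + y) - g x) ^ 2 ∂K)
          + 2 * (C ^ 2 * ρ ^ 2) * ∫ y in ball 0 ρ \ ball 0 τ, ‖y‖ ^ 2 ∂K := by
          rw [integral_add ((hsq.mono_set hsub).const_mul 2) (hPA.const_mul _),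
            integral_const_mul, integral_const_mul]
      _ ≤ 2 * D + 2 * (C ^ 2 * ρ ^ 2) * P := by gcongr
      _ = _ := by ring
  have h4 : ∫ y in ball 0 τ, ⟪v, y⟫ ^ 2 ∂K ≤ ‖v‖ ^ 2 * p := by
    calc ∫ y in ball 0 τ, ⟪v, y⟫ ^ 2 ∂K ≤ ∫ y in ball 0 τ, ‖v‖ ^ 2 * ‖y‖ ^ 2 ∂K := by
          refine setIntegral_mono (hI.mono_set (ball_subset_ball hτρ))
            ((hP.1.mono_set (ball_subset_ball hτρ)).const_mul _) fun y => ?_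
          have := pow_le_pow_left₀ (abs_nonneg _) (abs_real_inner_le_norm v y) 2
          rwa [sq_abs, mul_pow] at this
      _ ≤ _ := by
          rw [integral_const_mul]
          gcongr
  have h5 : ∫ y in ball 0 ρ, ⟪v, y⟫ ^ 2 ∂K = (∫ y in ball 0 τ, ⟪v, y⟫ ^ 2 ∂K)
      + ∫ y in ball 0 ρ \ ball 0 τ, ⟪v, y⟫ ^ 2 ∂K := by
    rw [← setIntegral_union disjoint_sdiff_right hmeas
      (hI.mono_set (ball_subset_ball hτρ)) (hI.mono_set sdiff_subset),
      union_sdiff_cancel (ball_subset_ball hτρ)]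
  linarith

theorem sd_two_smul (g : Euc n → ℝ) (x y : Euc n) :
    sd g x ((2 : ℝ) • y) = sd g (x + y) y + 2 * sd g x y + sd g (x - y) y := by
  have e1 : x + (y + y) = x + y + y := by abel
  have e2 : x - (y + y) = x - y - y := by abel
  simp only [sd, two_smul, e1, e2, add_sub_cancel_right, sub_add_cancel]
  ring

/-- If second differences in a direction vary slowly, sublinear growth of
second differences makes them small. -/
theorem abs_sd_le_of_lipschitz {g : Euc n → ℝ} {h : Euc n} {γ β : ℝ} (hγ : 0 ≤ γ) (hβ0 : 0 ≤ β)
    (hL : ∀ x z, |sd g x h - sd g z h| ≤ γ * ‖x - z‖) (hβ : ∀ x y, |sd g x y| ≤ ‖y‖ ^ β)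
    (hh : ‖h‖ ≤ 1) (k : ℕ) (x : Euc n) : |sd g x h| ≤ 2 ^ k * γ + (2 ^ (β - 2)) ^ k := by
  have ind : ∀ k : ℕ, (∀ x z, |sd g x ((2 : ℝ) ^ k • h) - sd g z ((2 : ℝ) ^ k • h)|
      ≤ 4 ^ k * (γ * ‖x - z‖)) ∧
      ∀ x, |sd g x ((2 : ℝ) ^ k • h) - 4 ^ k * sd g x h| ≤ 4 ^ k * (2 ^ k * γ) := by
    intro k
    induction k with
    | zero => simpa using ⟨hL, hγ⟩
    | succ k ih =>
      obtain ⟨ih1, ih2⟩ := ih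
      have e : (2 : ℝ) ^ (k + 1) • h = (2 : ℝ) • ((2 : ℝ) ^ k • h) := by
        rw [smul_smul, ← pow_succ']
      rw [e, pow_succ (4 : ℝ), pow_succ (2 : ℝ)]
      set y := (2 : ℝ) ^ k • h with hy
      have hyn : ‖y‖ ≤ 2 ^ k := by
        rw [hy, norm_smul, Real.norm_of_nonneg (by positivity)]
        exact mul_le_of_le_one_right (by positivity) hh
      refine ⟨fun x z => ?_, fun x => ?_⟩
      · have a1 := abs_le.mp (ih1 (x + y) (z + y))
        have a2 := abs_le.mp (ih1 (x - y) (z - y))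
        have a3 := abs_le.mp (ih1 x z)
        rw [add_sub_add_right_eq_sub] at a1
        rw [sub_sub_sub_cancel_right] at a2
        rw [sd_two_smul, sd_two_smul, abs_le]
        constructor <;> linarith [a1.1, a1.2, a2.1, a2.2, a3.1, a3.2]
      · have a1 := abs_le.mp (ih1 (x + y) x)
        have a2 := abs_le.mp (ih1 (x - y) x)
        have a3 := abs_le.mp (ih2 x)
        rw [add_sub_cancel_left] at a1
        rw [sub_sub_cancel_left, norm_neg] at a2
        have a4 : (4 : ℝ) ^ k * (γ * ‖y‖) ≤ 4 ^ k * (γ * 2 ^ k) := by gcongr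
        have a5 : 0 ≤ (4 : ℝ) ^ k * (γ * 2 ^ k) := by positivity
        rw [sd_two_smul, abs_le]
        constructor <;> linarith [a1.1, a1.2, a2.1, a2.2, a3.1, a3.2]
  have h1 := (ind k).2 x
  have h2 := hβ x ((2 : ℝ) ^ k • h)
  have h3 : ‖(2 : ℝ) ^ k • h‖ ^ β ≤ 4 ^ k * (2 ^ (β - 2)) ^ k := by
    have e1 : ‖(2 : ℝ) ^ k • h‖ ≤ 2 ^ k := by
      rw [norm_smul, Real.norm_of_nonneg (by positivity)]
      exact mul_le_of_le_one_right (by positivity) hh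
    refine (Real.rpow_le_rpow (norm_nonneg _) e1 hβ0).trans (le_of_eq ?_)
    have e2 : (2 : ℝ) ^ β = 4 * 2 ^ (β - 2) := by
      rw [Real.rpow_sub two_pos]
      norm_num
      ring
    rw [← mul_pow, ← e2, ← Real.rpow_natCast, ← Real.rpow_natCast, ← Real.rpow_mul two_pos.le,
      ← Real.rpow_mul two_pos.le, mul_comm]
  have h4 : (0 : ℝ) < 4 ^ k := by positivity
  have h5 : 4 ^ k * |sd g x h| ≤ 4 ^ k * (2 ^ k * γ + (2 ^ (β - 2)) ^ k) := by
    have := abs_sub_abs_le_abs_sub (4 ^ k * sd g x h) (sd g x ((2 : ℝ) ^ k • h))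
    rw [abs_sub_comm, abs_mul, abs_of_pos h4] at this
    linarith
  exact le_of_mul_le_mul_left h5 h4

/-- Second differences of the twice iterated resolvent are small. -/
theorem abs_sd_resKer_resKer_le {s β lam Lam τ ρ R T C P p γ : ℝ} {K : Measure (Euc n)}
    (hK : UnifElliptic s lam Lam K) (hKτ : K (ball 0 τ)ᶜ < ⊤) {w : Euc n → ℝ} (hw : IsBC w)
    (hβ0 : 0 ≤ β) (hβ : ∀ x y, |sd w x y| ≤ ‖y‖ ^ β) (hC : ∀ x y, |sd w x y| ≤ C * ‖y‖ ^ 2)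
    (hT : 0 < T) (hτρ : τ ≤ ρ) (hρR : ρ ≤ R) (hρ : 0 < ρ) (hγ : 0 ≤ γ)
    (hP : IntegrableOn (fun y => ‖y‖ ^ 2) (ball 0 ρ) K ∧ ∫ y in ball 0 ρ, ‖y‖ ^ 2 ∂K ≤ P)
    (hp : ∫ y in ball 0 τ, ‖y‖ ^ 2 ∂K ≤ p) (hlow : 0 < lam * ρ ^ (2 - 2 * s) - p)
    (hγle : 2 * (1 / T) + 2 * ((4 * C) ^ 2 * ρ ^ 2 * P) ≤ γ ^ 2 * (lam * ρ ^ (2 - 2 * s) - p))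
    (hdiff : Differentiable ℝ (avg (resKer T (K.restrict (ball 0 R \ ball 0 τ)))
      (avg (resKer T (K.restrict (ball 0 R \ ball 0 τ))) w)))
    {h : Euc n} (hh : ‖h‖ ≤ 1) (k : ℕ) (x : Euc n) :
    |sd (avg (resKer T (K.restrict (ball 0 R \ ball 0 τ)))
      (avg (resKer T (K.restrict (ball 0 R \ ball 0 τ))) w)) x h|
      ≤ 2 ^ k * γ + (2 ^ (β - 2)) ^ k := by
  have : IsFiniteMeasure (K.restrict (ball 0 R \ ball 0 τ)) :=
    ⟨by rw [Measure.restrict_apply_univ]; exact (measure_mono fun y hy => hy.2).trans_lt hKτ⟩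
  have := isProbabilityMeasure_resKer hT.le (K.restrict (ball 0 R \ ball 0 τ))
  set μ := K.restrict (ball 0 R \ ball 0 τ) with hμ
  set W := avg (resKer T μ) (avg (resKer T μ) w) with hW
  have hw1 : IsBC (avg (resKer T μ) w) := hw.avg _
  have hWC : ∀ x y, |sd W x y| ≤ C * ‖y‖ ^ 2 := fun x y =>
    abs_sd_avg_le hw1 _ (fun z => abs_sd_avg_le hw _ (fun z => hC z y) z) x
  have hWβ : ∀ x y, |sd W x y| ≤ ‖y‖ ^ β := fun x y =>
    abs_sd_avg_le hw1 _ (fun z => abs_sd_avg_le hw _ (fun z => hβ z y) z) x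
  set Ψ : Euc n → ℝ := fun z => sd W z h with hΨ
  have hΨbc : IsBC Ψ := (hw1.avg _).sd_left h
  have hΨeq : Ψ = avg (resKer T μ) (avg (resKer T μ) fun z => sd w z h) := by
    ext z
    exact (sd_avg hw1 _ _ _).trans (congrArg (avg _ · z) (funext fun z => sd_avg hw _ _ _))
  have hcdc : ∀ z, cdc μ Ψ z ≤ 1 / T := by
    intro z
    rw [hΨeq]
    refine cdc_resKer_resKer_le hT (hw.sd_left h) (fun z => (hβ z h).trans ?_) z
    exact Real.rpow_le_one (norm_nonneg _) hh hβ0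
  have hΨC : ∀ z y, |sd Ψ z y| ≤ 4 * C * ‖y‖ ^ 2 := by
    intro z y
    have a1 := abs_le.mp (hWC (z + h) y)
    have a2 := abs_le.mp (hWC (z - h) y)
    have a3 := abs_le.mp (hWC z y)
    have e : sd Ψ z y = sd W (z + h) y + sd W (z - h) y - 2 * sd W z y := by
      have e1 : z + y - h = z - h + y := by abel
      have e2 : z - y + h = z + h - y := by abel
      simp only [hΨ, sd, add_right_comm z y h, sub_right_comm z y h, e1, e2]
      ring
    rw [e, abs_le]
    constructor <;> linarith [a1.1, a1.2, a2.1, a2.2, a3.1, a3.2]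
  have hΨd : Differentiable ℝ Ψ := by
    have : Differentiable ℝ W := hdiff
    simp only [hΨ, sd]
    fun_prop
  have hgrad : ∀ z, ‖fderiv ℝ Ψ z‖ ≤ γ := by
    intro z
    have h1 := sq_norm_gradient_le (v := (InnerProductSpace.toDual ℝ (Euc n)).symm (fderiv ℝ Ψ z))
      hK hKτ hΨbc (fun y => by
        rw [InnerProductSpace.toDual_symm_apply]
        exact abs_taylor_le_of_sd (hΨd z) hΨC y) hτρ hρR hρ hP hp (hcdc z)
    rw [LinearIsometryEquiv.norm_map] at h1
    exact le_of_sq_le_sq (le_of_mul_le_mul_right (h1.trans hγle) hlow) hγ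
  refine abs_sd_le_of_lipschitz hγ hβ0 (fun x z => ?_) hWβ hh k x
  exact convex_univ.norm_image_sub_le_of_norm_fderiv_le (fun z _ => hΨd z) (fun z _ => hgrad z)
    (mem_univ z) (mem_univ x)

theorem exists_pos_mul_rpow_le {p t₀ A δ : ℝ} (hp : 0 < p) (ht₀ : 0 < t₀) (hA : 0 ≤ A)
    (hδ : 0 < δ) : ∃ t, 0 < t ∧ t ≤ t₀ ∧ A * t ^ p ≤ δ := by
  have hq : 0 < δ / (A + 1) := by positivity
  refine ⟨min t₀ ((δ / (A + 1)) ^ p⁻¹), lt_min ht₀ (Real.rpow_pos_of_pos hq _),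
    min_le_left _ _, ?_⟩
  have h1 : min t₀ ((δ / (A + 1)) ^ p⁻¹) ^ p ≤ δ / (A + 1) := by
    calc min t₀ ((δ / (A + 1)) ^ p⁻¹) ^ p ≤ ((δ / (A + 1)) ^ p⁻¹) ^ p :=
          Real.rpow_le_rpow (le_min ht₀.le (by positivity)) (min_le_right _ _) hp.le
      _ = δ / (A + 1) := Real.rpow_inv_rpow hq.le hp.ne'
  calc A * min t₀ ((δ / (A + 1)) ^ p⁻¹) ^ p ≤ A * (δ / (A + 1)) := by gcongr
    _ = A / (A + 1) * δ := by ring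
    _ ≤ 1 * δ := by
        gcongr
        rw [div_le_one (by positivity)]
        linarith
    _ = δ := one_mul δ

set_option maxHeartbeats 1000000 in
/-- The a priori estimate at unit scale for second differences at the origin. -/
theorem exists_abs_sd_le {s β lam Lam : ℝ} (n : ℕ) (hs : s < 1) (hβ0 : 0 < β) (hβ : β < 2 * s)
    (hlam : 0 < lam) (hlamLam : lam ≤ Lam) {δ : ℝ} (hδ : 0 < δ) :
    ∃ D > (0 : ℝ), ∃ C > (0 : ℝ), ∃ η > (0 : ℝ), ∀ (K : Euc n → Measure (Euc n)) (u : Euc n → ℝ)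
      (F : ℝ), (∀ x, K x {0} = 0) → (∀ x, Measure.map (fun y => -y) (K x) = K x) →
      (∀ x, UnifElliptic s lam Lam (K x)) → IsBC u → (∀ x y, |sd u x y| ≤ ‖y‖ ^ β) →
      (∀ x ρ, 0 < ρ → |(∫ y in ball 0 (2 * ρ) \ ball 0 ρ, sd u x y ∂K x) -
        ∫ y in ball 0 (2 * ρ) \ ball 0 ρ, sd u x y ∂K 0| ≤ η * ρ ^ (β - 2 * s)) →
      (∀ x ∈ closedBall 0 D, Integrable (sd u x) (K x) ∧ |1 / 2 * ∫ y, sd u x y ∂K x| ≤ F) →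
      ∀ h, ‖h‖ ≤ 1 → |sd u 0 h| ≤ δ + C * F := by
  have hLam : 0 < Lam := hlam.trans_le hlamLam
  have h2s : 0 < 2 - 2 * s := by linarith
  have hp2 : (2 : ℝ) ^ (β - 2) < 1 := Real.rpow_lt_one_of_one_lt_of_neg one_lt_two (by linarith)
  obtain ⟨c₁, hc₁, hinner⟩ : ∃ c₁ > (0 : ℝ), ∀ (K : Measure (Euc n)), K {0} = 0 →
      UnifElliptic s lam Lam K → ∀ r, 0 < r → IntegrableOn (fun y => ‖y‖ ^ 2) (ball 0 r) K ∧
        ∫ y in ball 0 r, ‖y‖ ^ 2 ∂K ≤ c₁ * r ^ (2 - 2 * s) := by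
    have : ((1 : ℝ) / 2) ^ (2 - 2 * s) < 1 :=
      Real.rpow_lt_one (by norm_num) (by norm_num) h2s
    have := sub_pos.mpr this
    exact ⟨_, by positivity, fun K h0 hK r hr => AnnulusBound.inner hK.1 h0 hLam.le hs hr⟩
  obtain ⟨c₂, hc₂, houter⟩ : ∃ c₂ > (0 : ℝ), ∀ (K : Measure (Euc n)), K {0} = 0 →
      UnifElliptic s lam Lam K → ∀ r, 0 < r → IntegrableOn (fun y => ‖y‖ ^ β) (ball 0 r)ᶜ K ∧
        ∫ y in (ball 0 r)ᶜ, ‖y‖ ^ β ∂K ≤ c₂ * r ^ (β - 2 * s) := by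
    have : (2 : ℝ) ^ (β - 2 * s) < 1 := Real.rpow_lt_one_of_one_lt_of_neg one_lt_two (by linarith)
    have := sub_pos.mpr this
    exact ⟨_, by positivity, fun K h0 hK r hr => AnnulusBound.outer hK.1 h0 hLam.le hβ0 hβ hr⟩
  obtain ⟨k, hk⟩ := exists_pow_lt_of_lt_one (by positivity : 0 < δ / 8) hp2
  set γ := δ / 8 / 2 ^ k with hγ
  have hγ0 : 0 < γ := by positivity
  have hγk : 2 ^ k * γ = δ / 8 := by rw [hγ]; field_simp
  obtain ⟨ε, hε, hε1, hεδ⟩ := exists_pos_mul_rpow_le hβ0 one_pos zero_le_four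
    (by positivity : 0 < δ / 8)
  obtain ⟨ν, hν, hνd, Cε, hCε, hmol⟩ := exists_mollifier n hβ0 (by linarith) hε hε1
  obtain ⟨ρ, hρ, -, hρδ⟩ := exists_pos_mul_rpow_le two_pos one_pos
    (by positivity : 0 ≤ 2 * (4 * Cε) ^ 2 * c₁) (by positivity : 0 < γ ^ 2 * lam / 4)
  rw [Real.rpow_two] at hρδ
  set P := ρ ^ (2 - 2 * s) with hP
  have hP0 : 0 < P := by positivity
  set T := 8 / (γ ^ 2 * lam * P) with hT
  have hT0 : 0 < T := by positivity
  obtain ⟨τ, hτ, hτρ, hτδ⟩ := exists_pos_mul_rpow_le h2s hρ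
    (by positivity : 0 ≤ c₁ + 4 * T * Cε * c₁)
    (by positivity : 0 < min (lam * P / 2) (δ / 16))
  have hτ0 : 0 ≤ c₁ * τ ^ (2 - 2 * s) := by positivity
  have hτ1 : 0 ≤ 4 * T * Cε * (c₁ * τ ^ (2 - 2 * s)) := by positivity
  have hτa : c₁ * τ ^ (2 - 2 * s) ≤ lam * P / 2 := by
    linarith [hτδ.trans (min_le_left _ _)]
  have hτb : 4 * T * Cε * (c₁ * τ ^ (2 - 2 * s)) ≤ δ / 16 := by
    linarith [hτδ.trans (min_le_right _ _)]
  obtain ⟨N, hNρ, hNδ⟩ : ∃ N : ℕ, ρ ≤ τ * 2 ^ N ∧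
      4 * T * (c₂ * (τ * 2 ^ N) ^ (β - 2 * s)) ≤ δ / 16 := by
    obtain ⟨t, ht, htρ, htδ⟩ := exists_pos_mul_rpow_le (by linarith : 0 < 2 * s - β)
      (inv_pos.mpr hρ) (by positivity : 0 ≤ 4 * T * c₂) (by positivity : 0 < δ / 16)
    obtain ⟨N, hN⟩ := pow_unbounded_of_one_lt (t⁻¹ / τ) one_lt_two
    rw [div_lt_iff₀ hτ, mul_comm] at hN
    refine ⟨N, ((le_inv_comm₀ ht hρ).mp htρ).trans hN.le, ?_⟩
    have h1 : (τ * 2 ^ N) ^ (β - 2 * s) ≤ (t⁻¹) ^ (β - 2 * s) :=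
      Real.rpow_le_rpow_of_nonpos (inv_pos.mpr ht) hN.le (by linarith)
    rw [Real.inv_rpow ht.le, ← Real.rpow_neg ht.le, neg_sub] at h1
    calc 4 * T * (c₂ * (τ * 2 ^ N) ^ (β - 2 * s)) ≤ 4 * T * (c₂ * t ^ (2 * s - β)) := by gcongr
      _ = 4 * T * c₂ * t ^ (2 * s - β) := by ring
      _ ≤ _ := htδ
  set R := τ * 2 ^ N with hR
  have hR0 : 0 < R := by positivity
  set B := c₂ * τ ^ (β - 2 * s) with hB
  set C₀ := ε ^ β + 2 * (T * B) with hC₀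
  have hB0 : 0 ≤ B := by positivity
  have hC₀0 : 0 ≤ C₀ := by positivity
  set m := c₁ * R ^ (2 - 2 * s) with hm
  have hm0 : 0 ≤ m := by positivity
  obtain ⟨t, ht, -, htδ⟩ := exists_pos_mul_rpow_le two_pos one_pos
    (by positivity : 0 ≤ 16 * T * C₀ * (c₁ * τ ^ (2 - 2 * s) + m)) (by positivity : 0 < δ / 16)
  rw [Real.rpow_two] at htδ
  have hq : 4 * T * (4 * C₀ / t⁻¹ ^ 2 * (c₁ * τ ^ (2 - 2 * s) + m)) ≤ δ / 16 := by
    rw [inv_pow, div_inv_eq_mul]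
    linarith
  set c := (δ / 16) / (4 * T * (N * τ ^ (β - 2 * s)) + 1) with hc
  have hc0 : 0 < c := by positivity
  have hcδ : 4 * T * (c * (N * τ ^ (β - 2 * s))) ≤ δ / 16 := by
    have e : 4 * T * (c * (N * τ ^ (β - 2 * s)))
        = (4 * T * (N * τ ^ (β - 2 * s))) / (4 * T * (N * τ ^ (β - 2 * s)) + 1) * (δ / 16) := by
      rw [hc]; ring
    rw [e]
    refine mul_le_of_le_one_left (by positivity) ?_
    rw [div_le_one (by positivity)]
    linarith
  refine ⟨1 + 2 * t⁻¹, by positivity, 8 * T, by positivity, c, hc0, ?_⟩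
  intro K u F hK0 hKs hK hu hsd hKant hsol h hh
  have hfin : ∀ x, K x (ball 0 τ)ᶜ < ⊤ := fun x =>
    AnnulusBound.measure_compl_ball_lt_top (hK x).1 (hK0 x) hLam.le hβ0 hβ hτ
  have hτR : τ ≤ R := hτρ.trans hNρ
  have hfinA : IsFiniteMeasure ((K 0).restrict (ball 0 R \ ball 0 τ)) :=
    ⟨by rw [Measure.restrict_apply_univ]; exact (measure_mono fun y hy => hy.2).trans_lt (hfin 0)⟩
  have hprob := isProbabilityMeasure_resKer hT0.le ((K 0).restrict (ball 0 R \ ball 0 τ))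
  have hsymm : Measure.map (fun y => -y) ((K 0).restrict (ball 0 R \ ball 0 τ))
      = (K 0).restrict (ball 0 R \ ball 0 τ) := by
    have hA : (fun y : Euc n => -y) ⁻¹' (ball 0 R \ ball 0 τ) = ball 0 R \ ball 0 τ := by
      ext y
      simp
    conv_rhs => rw [← hKs 0]
    rw [Measure.restrict_map (by fun_prop) (measurableSet_ball.diff measurableSet_ball), hA]
  have hvisc : ∀ (v : Euc n → ℝ) x, IsBC v → (∀ y, |sd v x y| ≤ ‖y‖ ^ β) →
      Integrable (sd v x) (K x) → -(1 / 2 * ∫ y, sd v x y ∂K x) ≤ F →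
      (∀ ρ, 0 < ρ → |(∫ y in ball 0 (2 * ρ) \ ball 0 ρ, sd v x y ∂K x) -
        ∫ y in ball 0 (2 * ρ) \ ball 0 ρ, sd v x y ∂K 0| ≤ c * ρ ^ (β - 2 * s)) →
      ViscSub ((K 0).restrict (ball 0 R \ ball 0 τ)) v Cε (4 * C₀ / t⁻¹ ^ 2)
        (F + 1 / 2 * ((Cε + 4 * C₀ / t⁻¹ ^ 2) * (c₁ * τ ^ (2 - 2 * s)) +
          c₂ * R ^ (β - 2 * s) + c * (N * τ ^ (β - 2 * s)) + 4 * C₀ / t⁻¹ ^ 2 * m)) x := by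
    intro v x hv hvβ hint hF hkan
    have hI : ∀ z, IntegrableOn (sd v x) (ball 0 τ)ᶜ (K z) := by
      intro z
      have : IsFiniteMeasure ((K z).restrict (ball 0 τ)ᶜ) :=
        ⟨by rw [Measure.restrict_apply_univ]; exact hfin z⟩
      exact (hv.sd x).integrable _
    exact viscSub_of_integral hv hvβ hτR hCε (by positivity) (hfin 0) hint hF
      (abs_setIntegral_sub_le_sum hτ hc0.le (by linarith) (hI x) (hI 0) hkan N)
      (hinner _ (hK0 x) (hK x) τ hτ) (houter _ (hK0 x) (hK x) R hR0)
      (hinner _ (hK0 0) (hK 0) R hR0)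
  obtain ⟨hS, hwC⟩ := hmol u hu hsd
  have hw : IsBC (avg ν u) := hu.avg ν
  have hwβ : ∀ x y, |sd (avg ν u) x y| ≤ ‖y‖ ^ β := fun x y =>
    abs_sd_avg_le hu ν (fun z => hsd z y) x
  have hBint : Integrable (fun y => ‖y‖ ^ β) ((K 0).restrict (ball 0 R \ ball 0 τ)) ∧
      ∫ y, ‖y‖ ^ β ∂((K 0).restrict (ball 0 R \ ball 0 τ)) ≤ B := by
    obtain ⟨h1, h2⟩ := houter _ (hK0 0) (hK 0) τ hτ
    have hsub : ball (0 : Euc n) R \ ball 0 τ ⊆ (ball 0 τ)ᶜ := fun y hy => hy.2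
    exact ⟨h1.mono_set hsub, (setIntegral_mono_set h1
      (Filter.Eventually.of_forall fun y => by positivity) hsub.eventuallyLE).trans h2⟩
  have hclose := fun x hx => abs_sub_resKer_resKer_le (x := x) hsymm hu hw hwβ hwC hS hT0.le hBint
    (inv_pos.mpr ht)
    (fun x hx => hvisc u x hu (hsd x) (hsol x hx).1
      (by linarith [(abs_le.mp (hsol x hx).2).1]) (hKant x))
    (fun x hx => by
      have e : sd (fun z => -u z) x = fun y => -sd u x y := funext (sd_neg u x)
      refine hvisc (fun z => -u z) x hu.neg (fun y => ?_) ?_ ?_ fun ρ hρ => ?_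
      · rw [sd_neg, abs_neg]
        exact hsd x y
      · rw [e]
        exact (hsol x hx).1.neg
      · rw [e, integral_neg]
        linarith [(abs_le.mp (hsol x hx).2).2]
      · rw [e, integral_neg, integral_neg, neg_sub_neg, abs_sub_comm]
        exact hKant x ρ hρ) hx
  set j := resKer T ((K 0).restrict (ball 0 R \ ball 0 τ)) with hj
  have hdiff : Differentiable ℝ (avg j (avg j (avg ν u))) := by
    have e : avg j (avg j (avg ν u)) = avg ν (avg j (avg j u)) := by
      have e1 : avg j (avg ν u) = avg ν (avg j u) := funext (avg_comm hu j ν)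
      rw [e1]
      exact funext (avg_comm (hu.avg j) j ν)
    rw [e]
    exact hνd _ ((hu.avg j).avg j)
  have hγle : 2 * (1 / T) + 2 * ((4 * Cε) ^ 2 * ρ ^ 2 * (c₁ * P))
      ≤ γ ^ 2 * (lam * P - c₁ * τ ^ (2 - 2 * s)) := by
    have e1 : 2 * (1 / T) = γ ^ 2 * lam * P / 4 := by
      rw [hT]
      field_simp
      norm_num
    have e2 := mul_le_mul_of_nonneg_right hρδ hP0.le
    have e3 := mul_le_mul_of_nonneg_left hτa (sq_nonneg γ)
    linarith
  have hmain := abs_sd_resKer_resKer_le (hK 0) (hfin 0) hw hβ0.le hwβ hwC hT0 hτρ hNρ hρ hγ0.le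
    (hinner _ (hK0 0) (hK 0) ρ hρ) (hinner _ (hK0 0) (hK 0) τ hτ).2
    (by nlinarith [mul_pos hlam hP0]) hγle hdiff hh k 0
  rw [← hj] at hmain
  have g1 := abs_le.mp (hclose (0 + h) (by simpa using hh))
  have g2 := abs_le.mp (hclose (0 - h) (by simpa using hh))
  have g3 := abs_le.mp (hclose 0 (by simp))
  set X := 4 * C₀ / t⁻¹ ^ 2
  set a := c₁ * τ ^ (2 - 2 * s)
  have hE : 8 * (T * (F + 1 / 2 * ((Cε + X) * a +
          c₂ * R ^ (β - 2 * s) + c * (N * τ ^ (β - 2 * s)) + X * m))) ≤ 8 * T * F + δ / 4 := by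
    linarith
  have hmain' := abs_le.mp hmain
  simp only [sd] at hmain' ⊢
  rw [abs_le]
  constructor <;> linarith [g1.1, g1.2, g2.1, g2.2, g3.1, g3.2, hmain'.1, hmain'.2]

/-- The jump measure of the operator rescaled by the factor `r`. -/
def rescale (s r : ℝ) (K : Measure (Euc n)) : Measure (Euc n) :=
  ENNReal.ofReal (r ^ (2 * s)) • Measure.map (fun y => r⁻¹ • y) K

theorem measurableEmbedding_inv_smul {r : ℝ} (hr : 0 < r) :
    MeasurableEmbedding fun y : Euc n => r⁻¹ • y :=
  measurableEmbedding_const_smul₀ (inv_ne_zero hr.ne')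

theorem preimage_inv_smul_ball {r : ℝ} (hr : 0 < r) (t : ℝ) :
    (fun y : Euc n => r⁻¹ • y) ⁻¹' ball 0 t = ball 0 (r * t) := by
  ext y
  rw [mem_preimage, mem_ball_zero_iff, mem_ball_zero_iff, norm_smul,
    Real.norm_of_nonneg (inv_pos.mpr hr).le, inv_mul_lt_iff₀ hr]

theorem setIntegral_rescale {s r : ℝ} (hr : 0 < r) (K : Measure (Euc n)) (S : Set (Euc n))
    (g : Euc n → ℝ) : ∫ y in S, g y ∂rescale s r K
      = r ^ (2 * s) * ∫ y in (fun y => r⁻¹ • y) ⁻¹' S, g (r⁻¹ • y) ∂K := by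
  rw [rescale, Measure.restrict_smul, integral_smul_measure,
    (measurableEmbedding_inv_smul hr).setIntegral_map,
    ENNReal.toReal_ofReal (by positivity), smul_eq_mul]

theorem integral_rescale {s r : ℝ} (hr : 0 < r) (K : Measure (Euc n)) (g : Euc n → ℝ) :
    ∫ y, g y ∂rescale s r K = r ^ (2 * s) * ∫ y, g (r⁻¹ • y) ∂K := by
  simpa using setIntegral_rescale (s := s) hr K univ g

theorem integrable_rescale {s r : ℝ} (hr : 0 < r) {K : Measure (Euc n)} {g : Euc n → ℝ}
    (hg : Integrable (fun y => g (r⁻¹ • y)) K) : Integrable g (rescale s r K) :=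
  ((measurableEmbedding_inv_smul hr).integrable_map_iff.mpr hg).smul_measure ENNReal.ofReal_ne_top

theorem UnifElliptic.rescale {s lam Lam r : ℝ} {K : Measure (Euc n)}
    (hK : UnifElliptic s lam Lam K) (hr : 0 < r) : UnifElliptic s lam Lam (rescale s r K) := by
  refine ⟨fun t ht => ?_, fun t ht e he => ?_⟩
  · have e1 : ENNReal.ofReal (t ^ (2 * s)) * ENNReal.ofReal (r ^ (2 * s))
        = ENNReal.ofReal ((r * t) ^ (2 * s)) := by
      rw [← ENNReal.ofReal_mul (by positivity), mul_comm, Real.mul_rpow hr.le ht.le]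
    rw [_root_.rescale, Measure.smul_apply, (measurableEmbedding_inv_smul hr).map_apply,
      preimage_sdiff, preimage_inv_smul_ball hr, preimage_inv_smul_ball hr, smul_eq_mul,
      ← mul_assoc, e1, mul_left_comm]
    exact hK.1 (r * t) (by positivity)
  · have h1 := hK.2 (r * t) (by positivity) e he
    rw [_root_.rescale, Measure.restrict_smul, lintegral_smul_measure,
      (measurableEmbedding_inv_smul hr).restrict_map, preimage_inv_smul_ball hr,
      (measurableEmbedding_inv_smul hr).lintegral_map]
    refine h1.trans (le_of_eq ?_)
    have e2 : ∀ y : Euc n, ENNReal.ofReal (⟪e, r⁻¹ • y⟫ ^ 2)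
        = ENNReal.ofReal (r⁻¹ ^ 2) * ENNReal.ofReal (⟪e, y⟫ ^ 2) := by
      intro y
      rw [← ENNReal.ofReal_mul (by positivity), real_inner_smul_right, mul_pow]
    simp only [e2]
    rw [lintegral_const_mul' _ _ ENNReal.ofReal_ne_top, smul_eq_mul, ← mul_assoc, ← mul_assoc,
      ← ENNReal.ofReal_mul (by positivity), ← ENNReal.ofReal_mul (by positivity)]
    congr 2
    rw [Real.mul_rpow hr.le ht.le, Real.rpow_sub hr, Real.rpow_two]
    field_simp

/-- The a priori estimate for second differences at all small scales. -/
theorem exists_abs_sd_le_mul_rpow {s β lam Lam : ℝ} (n : ℕ) (hs : s < 1) (hβ0 : 0 < β)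
    (hβ : β < 2 * s) (hlam : 0 < lam) (hlamLam : lam ≤ Lam) {δ : ℝ} (hδ : 0 < δ) :
    ∃ ρ > (0 : ℝ), ρ ≤ 1 / 4 ∧ ∃ C > (0 : ℝ), ∃ η > (0 : ℝ),
      ∀ (K : Euc n → Measure (Euc n)) (u : Euc n → ℝ)
      (F M : ℝ), 0 < M → (∀ x, K x {0} = 0) → (∀ x, Measure.map (fun y => -y) (K x) = K x) →
      (∀ x, UnifElliptic s lam Lam (K x)) → IsBC u → (∀ x y, |sd u x y| ≤ M * ‖y‖ ^ β) →
      (∀ x x' ρ, 0 < ρ → |(∫ y in ball 0 (2 * ρ) \ ball 0 ρ, sd u x y ∂K x) -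
        ∫ y in ball 0 (2 * ρ) \ ball 0 ρ, sd u x y ∂K x'| ≤ M * (η * ρ ^ (β - 2 * s))) →
      (∀ x ∈ ball 0 1, Integrable (sd u x) (K x) ∧ |1 / 2 * ∫ y, sd u x y ∂K x| ≤ F) →
      ∀ x ∈ ball 0 (3 / 4), ∀ h, ‖h‖ ≤ ρ → |sd u x h| ≤ (δ * M + C * F) * ‖h‖ ^ β := by
  obtain ⟨D, hD, C, hC, η, hη, hcore⟩ := exists_abs_sd_le n hs hβ0 hβ hlam hlamLam hδ
  have hρ1 : 1 / (4 * (D + 1)) ≤ 1 / 4 := by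
    rw [div_le_div_iff₀ (by positivity) (by norm_num)]
    linarith
  refine ⟨1 / (4 * (D + 1)), by positivity, hρ1, C, hC, η, hη, ?_⟩
  intro K u F M hM hK0 hKs hK hu hsd hKant hsol x₀ hx₀ h hh
  rcases eq_or_ne h 0 with rfl | hh0
  · simp [sd, Real.zero_rpow hβ0.ne']
    ring
  set r := ‖h‖ with hr_def
  have hr : 0 < r := norm_pos_iff.mpr hh0
  have hr1 : r ≤ 1 := hh.trans (hρ1.trans (by norm_num))
  have hrβ : 0 < r ^ β := Real.rpow_pos_of_pos hr β
  have hb : ∀ z ∈ closedBall (0 : Euc n) D, x₀ + r • z ∈ ball (0 : Euc n) 1 := by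
    intro z hz
    rw [mem_closedBall_zero_iff] at hz
    rw [mem_ball_zero_iff] at hx₀ ⊢
    have h1 : r * ‖z‖ ≤ 1 / (4 * (D + 1)) * D := by gcongr
    have h2 : 1 / (4 * (D + 1)) * D < 1 / 4 := by
      rw [div_mul_eq_mul_div, div_lt_div_iff₀ (by positivity) (by norm_num)]
      linarith
    have h3 := norm_add_le x₀ (r • z)
    rw [norm_smul, Real.norm_of_nonneg hr.le] at h3
    linarith
  have hF : 0 ≤ F := (abs_nonneg _).trans (hsol _ (hb 0 (by simpa using hD.le))).2
  set c := (M * r ^ β)⁻¹ with hc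
  have hc0 : 0 < c := by positivity
  have hcM : c * (M * r ^ β) = 1 := inv_mul_cancel₀ (by positivity)
  set v : Euc n → ℝ := fun z => c * u (x₀ + r • z) with hv
  have hsdv : ∀ z y, sd v z y = c * sd u (x₀ + r • z) (r • y) := by
    intro z y
    have e1 : x₀ + r • (z + y) = x₀ + r • z + r • y := by rw [smul_add, add_assoc]
    have e2 : x₀ + r • (z - y) = x₀ + r • z - r • y := by rw [smul_sub, add_sub_assoc]
    simp only [sd, hv, e1, e2]
    ring
  have hsdv' : ∀ z y, sd v z (r⁻¹ • y) = c * sd u (x₀ + r • z) y := by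
    intro z y
    rw [hsdv, smul_inv_smul₀ hr.ne']
  have hvbc : IsBC v := by
    obtain ⟨huc, B, hB⟩ := hu
    exact IsBC.const_mul (g := fun z => u (x₀ + r • z)) ⟨by fun_prop, B, fun z => hB _⟩ c
  have hres := hcore (fun z => rescale s r (K (x₀ + r • z))) v (F / M) (fun z => ?_) (fun z => ?_)
    (fun z => (hK _).rescale hr) hvbc (fun z y => ?_) (fun z t ht => ?_) (fun z hz => ?_)
    (r⁻¹ • h) (by rw [norm_smul, norm_inv, Real.norm_of_nonneg hr.le, inv_mul_cancel₀ hr.ne'])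
  · rw [hsdv', smul_zero, add_zero, abs_mul, abs_of_pos hc0] at hres
    calc |sd u x₀ h| = M * r ^ β * (c * |sd u x₀ h|) := by
          linear_combination -|sd u x₀ h| * hcM
      _ ≤ M * r ^ β * (δ + C * (F / M)) := by gcongr
      _ = _ := by field_simp
  · rw [rescale, Measure.smul_apply, (measurableEmbedding_inv_smul hr).map_apply]
    have : (fun y : Euc n => r⁻¹ • y) ⁻¹' {0} = {0} := by
      ext y
      simp [hr.ne']
    rw [this, hK0, smul_zero]
  · have h1 : Measurable fun y : Euc n => r⁻¹ • y := (measurableEmbedding_inv_smul hr).measurable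
    have h2 : Measurable fun y : Euc n => -y := measurable_neg
    rw [rescale, Measure.map_smul, Measure.map_map h2 h1]
    conv_rhs => rw [← hKs, Measure.map_map h1 h2]
    congr 2
    ext1 y
    simp
  · rw [hsdv, abs_mul, abs_of_pos hc0]
    calc c * |sd u (x₀ + r • z) (r • y)| ≤ c * (M * ‖r • y‖ ^ β) := by
          gcongr
          exact hsd _ _
      _ = c * (M * r ^ β) * ‖y‖ ^ β := by
          rw [norm_smul, Real.norm_of_nonneg hr.le, Real.mul_rpow hr.le (norm_nonneg _)]
          ring
      _ = ‖y‖ ^ β := by rw [hcM, one_mul]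
  · simp only [setIntegral_rescale hr, preimage_sdiff, preimage_inv_smul_ball hr, hsdv',
      integral_const_mul, smul_zero, add_zero]
    rw [← mul_sub, ← mul_sub, abs_mul, abs_mul, abs_of_pos hc0, abs_of_pos (by positivity)]
    have h1 := hKant (x₀ + r • z) x₀ (r * t) (by positivity)
    rw [mul_left_comm 2 r t] at h1
    calc _ ≤ r ^ (2 * s) * (c * (M * (η * (r * t) ^ (β - 2 * s)))) := by gcongr
      _ = c * (M * r ^ β) * (η * t ^ (β - 2 * s)) := by
          have e : r ^ (2 * s) * r ^ (β - 2 * s) = r ^ β := by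
            rw [← Real.rpow_add hr]
            congr 1
            ring
          rw [Real.mul_rpow hr.le ht.le]
          linear_combination c * M * η * t ^ (β - 2 * s) * e
      _ = _ := by rw [hcM, one_mul]
  · obtain ⟨h1, h2⟩ := hsol _ (hb z hz)
    refine ⟨integrable_rescale hr ?_, ?_⟩
    · simp only [hsdv']
      exact h1.const_mul c
    · rw [integral_rescale hr]
      simp only [hsdv', integral_const_mul]
      have e : 1 / 2 * (r ^ (2 * s) * (c * ∫ y, sd u (x₀ + r • z) y ∂K (x₀ + r • z)))
          = r ^ (2 * s) * c * (1 / 2 * ∫ y, sd u (x₀ + r • z) y ∂K (x₀ + r • z)) := by ring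
      rw [e, abs_mul, abs_of_pos (by positivity)]
      have h3 : r ^ (2 * s) ≤ r ^ β := Real.rpow_le_rpow_of_exponent_ge hr hr1 hβ.le
      calc _ ≤ r ^ β * c * F := by gcongr
        _ = F / M := by rw [hc]; field_simp

theorem hDeg_eq_zero {β : ℝ} (hβ : β ≤ 1) : hDeg β = 0 := by
  have : ⌈β⌉₊ ≤ 1 := Nat.ceil_le.mpr (by simpa using hβ)
  unfold hDeg
  omega

theorem hDeg_eq_one {β : ℝ} (h1 : 1 < β) (h2 : β ≤ 2) : hDeg β = 1 := by
  have h3 : ⌈β⌉₊ ≤ 2 := Nat.ceil_le.mpr (by simpa using h2)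
  have h4 : 1 < ⌈β⌉₊ := Nat.lt_ceil.mpr (by simpa using h1)
  unfold hDeg
  omega

theorem hDeg_mono {σ τ : ℝ} (h : σ ≤ τ) : hDeg σ ≤ hDeg τ :=
  Nat.sub_le_sub_right (Nat.ceil_mono h) 1

theorem norm_iteratedFDerivWithin_one_sub {Ω : Set (Euc n)} (hΩ : IsOpen Ω) (u : Euc n → ℝ)
    {x y : Euc n} (hx : x ∈ Ω) (hy : y ∈ Ω) :
    ‖iteratedFDerivWithin ℝ 1 u Ω x - iteratedFDerivWithin ℝ 1 u Ω y‖
      = ‖fderiv ℝ u x - fderiv ℝ u y‖ := by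
  rw [iteratedFDerivWithin_of_isOpen 1 hΩ hx, iteratedFDerivWithin_of_isOpen 1 hΩ hy]
  apply le_antisymm
  · refine ContinuousMultilinearMap.opNorm_le_bound (norm_nonneg _) fun m => ?_
    rw [sub_apply, iteratedFDeriv_one_apply, iteratedFDeriv_one_apply,
      ← sub_apply, Fin.prod_univ_one]
    exact ContinuousLinearMap.le_opNorm _ _
  · refine ContinuousLinearMap.opNorm_le_bound _ (norm_nonneg _) fun v => ?_
    have := ContinuousMultilinearMap.le_opNorm (iteratedFDeriv ℝ 1 u x - iteratedFDeriv ℝ 1 u y)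
      fun _ => v
    rwa [sub_apply, iteratedFDeriv_one_apply, iteratedFDeriv_one_apply,
      ← sub_apply, Fin.prod_univ_one] at this

theorem norm_iteratedFDerivWithin_zero_sub (Ω : Set (Euc n)) (u : Euc n → ℝ) (x y : Euc n) :
    ‖iteratedFDerivWithin ℝ 0 u Ω x - iteratedFDerivWithin ℝ 0 u Ω y‖ = |u x - u y| := by
  rw [iteratedFDerivWithin_zero_eq_comp]
  simp only [Function.comp_apply]
  rw [← map_sub, LinearIsometryEquiv.norm_map, Real.norm_eq_abs]

theorem hSemi_le_ofReal_iff {σ M : ℝ} (hM : 0 ≤ M) {Ω : Set (Euc n)} {u : Euc n → ℝ} :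
    hSemi σ Ω u ≤ ENNReal.ofReal M ↔ ∀ x ∈ Ω, ∀ y ∈ Ω,
      ‖iteratedFDerivWithin ℝ (hDeg σ) u Ω x - iteratedFDerivWithin ℝ (hDeg σ) u Ω y‖
        ≤ M * ‖x - y‖ ^ (σ - (hDeg σ : ℝ)) := by
  simp only [hSemi, hSemiOn, iSup_le_iff, Subtype.forall]
  refine forall₄_congr fun x _ y _ => ?_
  rw [ENNReal.ofReal_le_ofReal_iff hM]
  rcases eq_or_ne x y with rfl | hxy
  · simp only [sub_self, norm_zero, zero_div, hM, true_iff]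
    positivity
  · have : 0 < ‖x - y‖ := norm_pos_iff.mpr (sub_ne_zero.mpr hxy)
    rw [div_le_iff₀ (by positivity)]

theorem hSemi_le_ofReal_iff_of_lt_one {β M : ℝ} (hβ : β < 1) (hM : 0 ≤ M) {Ω : Set (Euc n)}
    {u : Euc n → ℝ} :
    hSemi β Ω u ≤ ENNReal.ofReal M ↔ ∀ x ∈ Ω, ∀ y ∈ Ω, |u x - u y| ≤ M * ‖x - y‖ ^ β := by
  rw [hSemi_le_ofReal_iff hM, hDeg_eq_zero hβ.le]
  simp only [norm_iteratedFDerivWithin_zero_sub, Nat.cast_zero, sub_zero]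

theorem hSemi_le_ofReal_iff_of_one_lt {β M : ℝ} (hβ : 1 < β) (hβ2 : β ≤ 2) (hM : 0 ≤ M)
    {Ω : Set (Euc n)} (hΩ : IsOpen Ω) {u : Euc n → ℝ} :
    hSemi β Ω u ≤ ENNReal.ofReal M ↔
      ∀ x ∈ Ω, ∀ y ∈ Ω, ‖fderiv ℝ u x - fderiv ℝ u y‖ ≤ M * ‖x - y‖ ^ (β - 1) := by
  rw [hSemi_le_ofReal_iff hM, hDeg_eq_one hβ hβ2]
  refine forall₄_congr fun x hx y hy => ?_
  rw [norm_iteratedFDerivWithin_one_sub hΩ u hx hy, Nat.cast_one]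

/-- The second differences of a function in the Hölder class of order `β` have order `β`. -/
theorem abs_sd_le_of_hSemi {β M : ℝ} (hβ1 : β ≠ 1) (hβ2 : β ≤ 2) (hM : 0 ≤ M)
    {u : Euc n → ℝ} (hu : ContDiff ℝ (hDeg β) u) (h : hSemi β univ u ≤ ENNReal.ofReal M)
    (x y : Euc n) : |sd u x y| ≤ 2 * M * ‖y‖ ^ β := by
  rcases lt_or_gt_of_ne hβ1 with hβ | hβ
  · rw [hSemi_le_ofReal_iff_of_lt_one hβ hM] at h
    have h1 := h (x + y) (mem_univ _) x (mem_univ _)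
    have h2 := h (x - y) (mem_univ _) x (mem_univ _)
    rw [add_sub_cancel_left] at h1
    rw [sub_sub_cancel_left, norm_neg] at h2
    calc |sd u x y| = |(u (x + y) - u x) + (u (x - y) - u x)| := by
          unfold sd
          congr 1
          ring
      _ ≤ |u (x + y) - u x| + |u (x - y) - u x| := abs_add_le _ _
      _ ≤ _ := by linarith
  · rw [hDeg_eq_one hβ hβ2] at hu
    rw [hSemi_le_ofReal_iff_of_one_lt hβ hβ2 hM isOpen_univ] at h
    rcases eq_or_ne y 0 with rfl | hy
    · have : sd u x 0 = 0 := by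
        unfold sd
        simp
        ring
      rw [this, abs_zero]
      positivity
    have hy' : 0 < ‖y‖ := norm_pos_iff.mpr hy
    have h2 : (2 : ℝ) ^ (β - 1) ≤ 2 := by
      calc (2 : ℝ) ^ (β - 1) ≤ 2 ^ (1 : ℝ) :=
            Real.rpow_le_rpow_of_exponent_le one_le_two (by linarith)
        _ = 2 := Real.rpow_one 2
    calc |sd u x y| ≤ M * (2 * ‖y‖) ^ (β - 1) * ‖y‖ :=
          abs_sd_le_of_fderiv (hu.differentiable (by simp)) (by linarith) hM
            (fun a b => h a (mem_univ _) b (mem_univ _)) x y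
      _ = M * (2 ^ (β - 1) * ‖y‖ ^ β) := by
          rw [Real.mul_rpow two_pos.le hy'.le, Real.rpow_sub_one hy'.ne']
          field_simp
      _ ≤ M * (2 * ‖y‖ ^ β) := by gcongr
      _ = _ := by ring

theorem contDiff_sd {k : ℕ} {u : Euc n → ℝ} (hu : ContDiff ℝ k u) (x : Euc n) :
    ContDiff ℝ k (sd u x) := by
  unfold sd
  fun_prop

theorem fderiv_const_mul_sd {u : Euc n → ℝ} (hu : Differentiable ℝ u) (c : ℝ) (x y : Euc n) :
    fderiv ℝ (fun z => c * sd u x z) y = c • (fderiv ℝ u (x + y) - fderiv ℝ u (x - y)) := by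
  have h1 := (hu (x + y)).hasFDerivAt.comp y ((hasFDerivAt_id y).const_add x)
  have h2 := (hu (x - y)).hasFDerivAt.comp y ((hasFDerivAt_id y).const_sub x)
  have h3 := (((h1.add h2).sub_const (2 * u x)).const_mul c).fderiv
  refine Eq.trans ?_ (h3.trans ?_)
  · rfl
  · ext w
    simp [sub_eq_add_neg]

theorem hSemi_const_mul_sd_le {β M : ℝ} (hβ1 : β ≠ 1) (hβ2 : β ≤ 2)
    (hM : 0 < M) {u : Euc n → ℝ} (hu : ContDiff ℝ (hDeg β) u)
    (h : hSemi β univ u ≤ ENNReal.ofReal M) (x : Euc n) :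
    hSemi β univ (fun y => (2 * M)⁻¹ * sd u x y) ≤ 1 := by
  rw [← ENNReal.ofReal_one]
  have e1 : ∀ y z : Euc n, x + y - (x + z) = y - z := fun y z => by abel
  have e2 : ∀ y z : Euc n, ‖x - y - (x - z)‖ = ‖y - z‖ := fun y z => by
    rw [← norm_neg]
    congr 1
    abel
  rcases lt_or_gt_of_ne hβ1 with hβ | hβ
  · rw [hSemi_le_ofReal_iff_of_lt_one hβ hM.le] at h
    rw [hSemi_le_ofReal_iff_of_lt_one hβ zero_le_one]
    intro y _ z _
    have h1 := h (x + y) (mem_univ _) (x + z) (mem_univ _)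
    have h2 := h (x - y) (mem_univ _) (x - z) (mem_univ _)
    rw [e1] at h1
    rw [e2] at h2
    rw [← mul_sub, abs_mul, abs_of_pos (by positivity)]
    have h3 : |sd u x y - sd u x z| ≤ 2 * M * ‖y - z‖ ^ β := by
      calc |sd u x y - sd u x z| = |(u (x + y) - u (x + z)) + (u (x - y) - u (x - z))| := by
            unfold sd
            congr 1
            ring
        _ ≤ _ := (abs_add_le _ _).trans (by linarith)
    calc (2 * M)⁻¹ * |sd u x y - sd u x z| ≤ (2 * M)⁻¹ * (2 * M * ‖y - z‖ ^ β) := by gcongr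
      _ = _ := by field_simp
  · rw [hDeg_eq_one hβ hβ2] at hu
    rw [hSemi_le_ofReal_iff_of_one_lt hβ hβ2 hM.le isOpen_univ] at h
    rw [hSemi_le_ofReal_iff_of_one_lt hβ hβ2 zero_le_one isOpen_univ]
    intro y _ z _
    have h1 := h (x + y) (mem_univ _) (x + z) (mem_univ _)
    have h2 := h (x - y) (mem_univ _) (x - z) (mem_univ _)
    rw [e1] at h1
    rw [e2] at h2
    have hd := hu.differentiable (by simp)
    rw [fderiv_const_mul_sd hd, fderiv_const_mul_sd hd, ← smul_sub, norm_smul,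
      Real.norm_of_nonneg (by positivity)]
    have h3 : ‖fderiv ℝ u (x + y) - fderiv ℝ u (x - y) - (fderiv ℝ u (x + z) - fderiv ℝ u (x - z))‖
        ≤ 2 * M * ‖y - z‖ ^ (β - 1) := by
      rw [sub_sub_sub_comm]
      exact (norm_sub_le _ _).trans (by linarith)
    calc _ ≤ (2 * M)⁻¹ * (2 * M * ‖y - z‖ ^ (β - 1)) := by gcongr
      _ = _ := by field_simp

theorem abs_sub_le_iterate_of_sd {β M A ρ : ℝ} (hβ1 : β ≤ 1) (hA : 0 ≤ A)
    {u : Euc n → ℝ} (hu : ∀ x h, |u (x + h) - u x| ≤ M * ‖h‖ ^ β)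
    (hsd : ∀ x ∈ ball (0 : Euc n) (3 / 4), ∀ h, ‖h‖ ≤ ρ → |sd u x h| ≤ A * ‖h‖ ^ β) (k : ℕ)
    (x h : Euc n) (hx : ‖x‖ + 2 ^ k * ‖h‖ < 3 / 4) (hh : 2 ^ k * ‖h‖ ≤ ρ) :
    |u (x + h) - u x| ≤ ((2 ^ (β - 1)) ^ k * M + k * A) * ‖h‖ ^ β := by
  induction k generalizing h with
  | zero => simpa using hu x h
  | succ k ih =>
    have hn : ‖(2 : ℝ) • h‖ = 2 * ‖h‖ := by rw [norm_smul, Real.norm_eq_abs, abs_two]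
    have h2 : 2 ^ k * ‖(2 : ℝ) • h‖ = 2 ^ (k + 1) * ‖h‖ := by
      rw [hn]
      ring
    have h1 := ih ((2 : ℝ) • h) (by rwa [h2]) (by rwa [h2])
    have hle : ‖h‖ ≤ 2 ^ (k + 1) * ‖h‖ :=
      le_mul_of_one_le_left (norm_nonneg h) (one_le_pow₀ one_le_two)
    have h3 := hsd (x + h)
      (mem_ball_zero_iff.mpr ((norm_add_le x h).trans_lt (by linarith))) h (hle.trans hh)
    have e : u (x + h) - u x = 1 / 2 * (u (x + (2 : ℝ) • h) - u x) - 1 / 2 * sd u (x + h) h := by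
      unfold sd
      rw [add_sub_cancel_right, add_assoc, ← two_smul ℝ h]
      ring
    have hq : (2 : ℝ) ^ (β - 1) ≤ 1 := Real.rpow_le_one_of_one_le_of_nonpos one_le_two (by linarith)
    have hp : 0 ≤ ‖h‖ ^ β := Real.rpow_nonneg (norm_nonneg h) β
    have h2β : (2 : ℝ) ^ β = 2 * 2 ^ (β - 1) := by
      rw [Real.rpow_sub_one two_ne_zero]
      ring
    rw [hn, Real.mul_rpow two_pos.le (norm_nonneg h), h2β] at h1
    rw [e]
    calc _ ≤ |1 / 2 * (u (x + (2 : ℝ) • h) - u x)| + |1 / 2 * sd u (x + h) h| := abs_sub _ _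
      _ = 1 / 2 * |u (x + (2 : ℝ) • h) - u x| + 1 / 2 * |sd u (x + h) h| := by
          rw [abs_mul, abs_mul, abs_of_pos (by norm_num : (0 : ℝ) < 1 / 2)]
      _ ≤ 1 / 2 * (((2 ^ (β - 1)) ^ k * M + k * A) * (2 * 2 ^ (β - 1) * ‖h‖ ^ β))
          + 1 / 2 * (A * ‖h‖ ^ β) := by gcongr
      _ = ((2 ^ (β - 1)) ^ (k + 1) * M + (2 ^ (β - 1) * (k * A) + 1 / 2 * A)) * ‖h‖ ^ β := by ring
      _ ≤ ((2 ^ (β - 1)) ^ (k + 1) * M + (1 * (k * A) + 1 * A)) * ‖h‖ ^ β := by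
          gcongr
          norm_num
      _ = _ := by
          push_cast
          ring

theorem abs_sub_le_of_sd {β M A U ρ : ℝ} (hβ0 : 0 < β) (hβ1 : β ≤ 1) (hM : 0 ≤ M) (hA : 0 ≤ A)
    (hU : 0 ≤ U) (hρ : 0 < ρ) (hρ4 : ρ ≤ 1 / 4) {u : Euc n → ℝ}
    (hu : ∀ x y, |u x - u y| ≤ M * ‖x - y‖ ^ β)
    (hsd : ∀ x ∈ ball (0 : Euc n) (3 / 4), ∀ h, ‖h‖ ≤ ρ → |sd u x h| ≤ A * ‖h‖ ^ β)
    (hb : ∀ x ∈ ball (0 : Euc n) 1, |u x| ≤ U) (k : ℕ) {x y : Euc n}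
    (hx : x ∈ ball (0 : Euc n) (1 / 2)) (hy : y ∈ ball (0 : Euc n) (1 / 2)) :
    |u x - u y| ≤ ((2 ^ (β - 1)) ^ k * M + k * A + 2 * U * (2 ^ k / ρ) ^ β) * ‖x - y‖ ^ β := by
  have hp : 0 ≤ ‖x - y‖ ^ β := Real.rpow_nonneg (norm_nonneg _) β
  have hy' : ‖y‖ < 1 / 2 := mem_ball_zero_iff.mp hy
  rcases le_or_gt (2 ^ k * ‖x - y‖) ρ with h | h
  · have := abs_sub_le_iterate_of_sd hβ1 hA
      (fun x h => by simpa using hu (x + h) x) hsd k y (x - y) (by linarith) h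
    rw [add_sub_cancel] at this
    refine this.trans (mul_le_mul_of_nonneg_right ?_ hp)
    exact le_add_of_nonneg_right (by positivity)
  · have h1 : 1 ≤ (2 ^ k / ρ * ‖x - y‖) ^ β := by
      refine Real.one_le_rpow ?_ hβ0.le
      rw [div_mul_eq_mul_div, one_le_div hρ]
      exact h.le
    rw [Real.mul_rpow (by positivity) (norm_nonneg _)] at h1
    have hs := ball_subset_ball (x := (0 : Euc n)) (by norm_num : (1 / 2 : ℝ) ≤ 1)
    calc |u x - u y| ≤ |u x| + |u y| := abs_sub _ _
      _ ≤ U + U := add_le_add (hb x (hs hx)) (hb y (hs hy))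
      _ = 2 * U * 1 := by ring
      _ ≤ 2 * U * ((2 ^ k / ρ) ^ β * ‖x - y‖ ^ β) := by gcongr
      _ = 0 + 2 * U * (2 ^ k / ρ) ^ β * ‖x - y‖ ^ β := by ring
      _ ≤ ((2 ^ (β - 1)) ^ k * M + k * A) * ‖x - y‖ ^ β + 2 * U * (2 ^ k / ρ) ^ β * ‖x - y‖ ^ β := by
          gcongr
          positivity
      _ = _ := by ring

theorem abs_taylor_le_of_fderiv {u : Euc n → ℝ} {M α : ℝ} (hu : Differentiable ℝ u) (hα : 0 ≤ α)
    (hM : 0 ≤ M) (h : ∀ a b, ‖fderiv ℝ u a - fderiv ℝ u b‖ ≤ M * ‖a - b‖ ^ α) (x w : Euc n) :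
    |u (x + w) - u x - fderiv ℝ u x w| ≤ M * ‖w‖ ^ α * ‖w‖ := by
  have := (convex_closedBall x ‖w‖).norm_image_sub_le_of_norm_fderiv_le' (f := u)
    (φ := fderiv ℝ u x) (C := M * ‖w‖ ^ α) (fun z _ => hu z) (fun z hz => ?_)
    (mem_closedBall_self (norm_nonneg w)) (by simp : x + w ∈ closedBall x ‖w‖)
  · simpa using this
  · refine (h z x).trans ?_
    rw [mem_closedBall_iff_norm] at hz
    gcongr

theorem norm_fderiv_sub_le_of_sd {β M A U ρ a : ℝ} (hβ1 : 1 < β) (hM : 0 ≤ M) (hA : 0 ≤ A)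
    (hU : 0 ≤ U) (hρ : 0 < ρ) (hρ4 : ρ ≤ 1 / 4) (ha : 0 < a) (ha1 : a ≤ 1) {u : Euc n → ℝ}
    (hud : Differentiable ℝ u)
    (hu : ∀ x y, ‖fderiv ℝ u x - fderiv ℝ u y‖ ≤ M * ‖x - y‖ ^ (β - 1))
    (hsd : ∀ x ∈ ball (0 : Euc n) (3 / 4), ∀ h, ‖h‖ ≤ ρ → |sd u x h| ≤ A * ‖h‖ ^ β)
    (hb : ∀ x ∈ ball (0 : Euc n) 1, |u x| ≤ U) {x y : Euc n}
    (hx : x ∈ ball (0 : Euc n) (1 / 2)) (hy : y ∈ ball (0 : Euc n) (1 / 2)) :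
    ‖fderiv ℝ u x - fderiv ℝ u y‖
      ≤ (2 * M * a ^ (β - 1) + 2 * A / a + 4 * U / (a * ρ ^ β)) * ‖x - y‖ ^ (β - 1) := by
  rcases eq_or_ne x y with rfl | hxy
  · simp only [sub_self, norm_zero]
    positivity
  set r := ‖x - y‖ with hr_def
  have hr : 0 < r := norm_pos_iff.mpr (sub_ne_zero.mpr hxy)
  have hα : 0 < β - 1 := sub_pos.mpr hβ1
  rw [mem_ball_zero_iff] at hx hy
  refine ContinuousLinearMap.opNorm_le_of_unit_norm (by positivity) fun v hv => ?_
  set t := a * min r ρ with ht_def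
  have hm : 0 < min r ρ := lt_min hr hρ
  have ht : 0 < t := by positivity
  have htm : t ≤ min r ρ := mul_le_of_le_one_left hm.le ha1
  have htr : t ≤ r := htm.trans (min_le_left _ _)
  have htρ : t ≤ ρ := htm.trans (min_le_right _ _)
  set w := t • v with hw_def
  have hw : ‖w‖ = t := by rw [norm_smul, hv, mul_one, Real.norm_of_nonneg ht.le]
  have hT : ∀ z, |u (z + w) - u z - fderiv ℝ u z w| ≤ M * t ^ (β - 1) * t := fun z =>
    hw ▸ abs_taylor_le_of_fderiv hud hα.le hM hu z w
  have hta : t ^ (β - 1) ≤ a ^ (β - 1) * r ^ (β - 1) := by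
    rw [← Real.mul_rpow ha.le hr.le]
    exact Real.rpow_le_rpow ht.le (mul_le_mul_of_nonneg_left (min_le_left _ _) ha.le) hα.le
  have hrβ : r ^ β = r ^ (β - 1) * r := by
    rw [Real.rpow_sub_one hr.ne']
    field_simp
  have hDD : |u (x + w) - u x - (u (y + w) - u y)|
      ≤ (2 * A / a + 4 * U / (a * ρ ^ β)) * r ^ (β - 1) * t := by
    rcases le_or_gt r ρ with h | h
    · have htr' : t = a * r := by rw [ht_def, min_eq_left h]
      set c := (2⁻¹ : ℝ) • (x + y + w) with hc
      set p := (2⁻¹ : ℝ) • (x - y + w) with hp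
      set q := (2⁻¹ : ℝ) • (x - y - w) with hq
      have e : u (x + w) - u x - (u (y + w) - u y) = sd u c p - sd u c q := by
        have e1 : c + p = x + w := by module
        have e2 : c - p = y := by module
        have e3 : c + q = x := by module
        have e4 : c - q = y + w := by module
        unfold sd
        rw [e1, e2, e3, e4]
        ring
      have hcb : c ∈ ball (0 : Euc n) (3 / 4) := by
        rw [mem_ball_zero_iff, hc, norm_smul, Real.norm_of_nonneg (by norm_num)]
        have := norm_add₃_le (a := x) (b := y) (c := w)
        linarith
      have hpn : ‖p‖ ≤ r := by
        rw [hp, norm_smul, Real.norm_of_nonneg (by norm_num)]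
        have := norm_add_le (x - y) w
        linarith
      have hqn : ‖q‖ ≤ r := by
        rw [hq, norm_smul, Real.norm_of_nonneg (by norm_num)]
        have := norm_sub_le (x - y) w
        linarith
      have hβ0 : 0 ≤ β := by linarith
      calc |u (x + w) - u x - (u (y + w) - u y)| ≤ |sd u c p| + |sd u c q| := by
            rw [e]
            exact abs_sub _ _
        _ ≤ A * ‖p‖ ^ β + A * ‖q‖ ^ β :=
            add_le_add (hsd c hcb p (hpn.trans h)) (hsd c hcb q (hqn.trans h))
        _ ≤ A * r ^ β + A * r ^ β := by gcongr
        _ = (2 * A / a + 0) * r ^ (β - 1) * t := by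
            rw [hrβ, htr']
            field_simp
            ring
        _ ≤ _ := by
            gcongr
            positivity
    · have htρ' : t = a * ρ := by rw [ht_def, min_eq_right h.le]
      have hbz : ∀ z : Euc n, ‖z‖ < 1 / 2 → |u (z + w) - u z| ≤ 2 * U := by
        intro z hz
        have h1 := hb z (mem_ball_zero_iff.mpr (by linarith))
        have h2 := hb (z + w) (mem_ball_zero_iff.mpr ((norm_add_le z w).trans_lt (by linarith)))
        exact (abs_sub _ _).trans (by linarith)
      have h1 : ρ ^ β ≤ r ^ (β - 1) * ρ := by
        calc ρ ^ β = ρ ^ (β - 1) * ρ := by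
              rw [Real.rpow_sub_one hρ.ne']
              field_simp
          _ ≤ _ := by gcongr
      have hρβ : 0 < ρ ^ β := Real.rpow_pos_of_pos hρ β
      calc |u (x + w) - u x - (u (y + w) - u y)| ≤ 2 * U + 2 * U :=
            (abs_sub _ _).trans (add_le_add (hbz x hx) (hbz y hy))
        _ = 4 * U / ρ ^ β * ρ ^ β := by
            field_simp
            ring
        _ ≤ 4 * U / ρ ^ β * (r ^ (β - 1) * ρ) := by gcongr
        _ = (0 + 4 * U / (a * ρ ^ β)) * r ^ (β - 1) * t := by
            rw [htρ']
            field_simp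
            ring
        _ ≤ _ := by
            gcongr
            positivity
  have key : t * |(fderiv ℝ u x - fderiv ℝ u y) v|
      ≤ t * ((2 * M * a ^ (β - 1) + 2 * A / a + 4 * U / (a * ρ ^ β)) * r ^ (β - 1)) := by
    have e : t * (fderiv ℝ u x - fderiv ℝ u y) v
        = u (x + w) - u x - (u (y + w) - u y) - (u (x + w) - u x - fderiv ℝ u x w)
          + (u (y + w) - u y - fderiv ℝ u y w) := by
      rw [hw_def, map_smul, map_smul, sub_apply, smul_eq_mul, smul_eq_mul]
      ring
    calc t * |(fderiv ℝ u x - fderiv ℝ u y) v| = |t * (fderiv ℝ u x - fderiv ℝ u y) v| := by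
          rw [abs_mul, abs_of_pos ht]
      _ ≤ (2 * A / a + 4 * U / (a * ρ ^ β)) * r ^ (β - 1) * t + M * t ^ (β - 1) * t
          + M * t ^ (β - 1) * t := by
          rw [e]
          exact (abs_add_le _ _).trans
            (add_le_add ((abs_sub _ _).trans (add_le_add hDD (hT x))) (hT y))
      _ ≤ (2 * A / a + 4 * U / (a * ρ ^ β)) * r ^ (β - 1) * t
          + M * (a ^ (β - 1) * r ^ (β - 1)) * t + M * (a ^ (β - 1) * r ^ (β - 1)) * t := by gcongr
      _ = _ := by ring
  exact le_of_mul_le_mul_left key ht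

theorem Lop_eq (K : Euc n → Measure (Euc n)) (u : Euc n → ℝ) (x : Euc n) :
    Lop K u x = -(1 / 2 * ∫ y, sd u x y ∂K x) := by
  unfold Lop sd
  rw [← mul_neg, ← integral_neg]
  congr 2
  ext y
  ring

theorem SolvesPtwise.integrable_sd {K : Euc n → Measure (Euc n)} {u f : Euc n → ℝ}
    {Ω : Set (Euc n)} (h : SolvesPtwise K u f Ω) {x : Euc n} (hx : x ∈ Ω) :
    Integrable (sd u x) (K x) := by
  refine (h x hx).1.neg.congr (Filter.Eventually.of_forall fun y => ?_)
  simp only [sd, Pi.neg_apply]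
  ring

/-- Second differences of the solution are small relative to its Hölder seminorm. -/
theorem exists_abs_sd_le_of_hSemi {s β lam Lam : ℝ} (n : ℕ) (hs : s < 1) (hβ0 : 0 < β)
    (hβ : β < 2 * s) (hβ1 : β ≠ 1) (hlam : 0 < lam) (hlamLam : lam ≤ Lam) {δ : ℝ} (hδ : 0 < δ) :
    ∃ ρ > (0 : ℝ), ρ ≤ 1 / 4 ∧ ∃ C > (0 : ℝ), ∃ η > (0 : ℝ),
      ∀ (K : Euc n → Measure (Euc n)) (u f : Euc n → ℝ) (F M : ℝ), 0 < M →
        (∀ x, IsLevyMeasure (K x)) → (∀ x, UnifElliptic s lam Lam (K x)) →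
        (∀ x x' : Euc n, KantCond s β (K x) (K x') η) → HasCompactSupport u →
        ContDiff ℝ (hDeg β) u → hSemi β univ u ≤ ENNReal.ofReal M →
        SolvesPtwise K u f (ball 0 1) → (∀ x ∈ ball 0 1, |f x| ≤ F) →
        ∀ x ∈ ball 0 (3 / 4), ∀ h, ‖h‖ ≤ ρ → |sd u x h| ≤ (δ * M + C * F) * ‖h‖ ^ β := by
  obtain ⟨ρ, hρ, hρ4, C, hC, η, hη, hmain⟩ :=
    exists_abs_sd_le_mul_rpow n hs hβ0 hβ hlam hlamLam (half_pos hδ)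
  refine ⟨ρ, hρ, hρ4, C, hC, η, hη, ?_⟩
  intro K u f F M hM hK hell hKant hcs hu hsemi hsol hf x hx h hh
  have hβ2 : β ≤ 2 := by linarith
  have e : δ / 2 * (2 * M) = δ * M := by ring
  rw [← e]
  refine hmain K u F (2 * M) (by positivity) (fun x => (hK x).1) (fun x => (hK x).2.2) hell
    ⟨hu.continuous, hcs.exists_bound_of_continuous hu.continuous⟩
    (abs_sd_le_of_hSemi hβ1 hβ2 hM.le hu hsemi) (fun x x' t ht => ?_) (fun x hx => ?_) x hx h hh
  · have h1 := hKant x x' t ht (fun y => (2 * M)⁻¹ * sd u x y)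
      (contDiff_const.mul (contDiff_sd hu x)) (hSemi_const_mul_sd_le hβ1 hβ2 hM hu hsemi x)
      (by simp only [sd, add_zero, sub_zero]; ring)
    rw [integral_const_mul, integral_const_mul, ← mul_sub, abs_mul, abs_of_pos (by positivity),
      inv_mul_le_iff₀ (by positivity)] at h1
    exact h1
  · refine ⟨hsol.integrable_sd hx, ?_⟩
    rw [← abs_neg, ← Lop_eq, (hsol x hx).2]
    exact hf x hx

theorem exists_hSemi_le {s β lam Lam : ℝ} (n : ℕ) (hs : s < 1) (hβ0 : 0 < β)
    (hβ : β < 2 * s) (hβ1 : β ≠ 1) (hlam : 0 < lam) (hlamLam : lam ≤ Lam) {δ : ℝ} (hδ : 0 < δ) :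
    ∃ C > (0 : ℝ), ∃ η > (0 : ℝ),
      ∀ (K : Euc n → Measure (Euc n)) (u f : Euc n → ℝ) (U F M : ℝ), 0 < M →
        (∀ x, IsLevyMeasure (K x)) → (∀ x, UnifElliptic s lam Lam (K x)) →
        (∀ x x' : Euc n, KantCond s β (K x) (K x') η) → HasCompactSupport u →
        ContDiff ℝ (hDeg β) u → hSemi β univ u ≤ ENNReal.ofReal M →
        SolvesPtwise K u f (ball 0 1) → 0 ≤ U → 0 ≤ F → (∀ x ∈ ball 0 1, |u x| ≤ U) →
        (∀ x ∈ ball 0 1, |f x| ≤ F) →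
        hSemi β (ball 0 (1 / 2)) u ≤ ENNReal.ofReal (δ * M + C * (U + F)) := by
  have hβ2 : β ≤ 2 := by linarith
  rcases lt_or_gt_of_ne hβ1 with hlt | hgt
  · obtain ⟨k, hk⟩ := exists_pow_lt_of_lt_one (half_pos hδ)
      (Real.rpow_lt_one_of_one_lt_of_neg one_lt_two (sub_neg.mpr hlt))
    obtain ⟨ρ, hρ, hρ4, C, hC, η, hη, hmain⟩ :=
      exists_abs_sd_le_of_hSemi n hs hβ0 hβ hβ1 hlam hlamLam
        (show 0 < δ / (2 * (k + 1)) by positivity)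
    refine ⟨k * C + 2 * (2 ^ k / ρ) ^ β, by positivity, η, hη, ?_⟩
    intro K u f U F M hM hK hell hKant hcs hu hsemi hsol hU hF hbu hbf
    have hsd := hmain K u f F M hM hK hell hKant hcs hu hsemi hsol hbf
    rw [hSemi_le_ofReal_iff_of_lt_one hlt hM.le] at hsemi
    rw [hSemi_le_ofReal_iff_of_lt_one hlt (by positivity)]
    intro x hx y hy
    refine (abs_sub_le_of_sd hβ0 hlt.le hM.le (by positivity) hU hρ hρ4
      (fun x y => hsemi x (mem_univ _) y (mem_univ _)) hsd hbu k hx hy).trans ?_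
    gcongr ?_ * _
    have h1 : (k : ℝ) * (δ / (2 * (k + 1))) ≤ δ / 2 := by
      rw [mul_div_assoc', div_le_div_iff₀ (by positivity) two_pos]
      nlinarith
    calc _ = (2 ^ (β - 1)) ^ k * M + k * (δ / (2 * (k + 1))) * M + (k * C * F
          + 2 * (2 ^ k / ρ) ^ β * U) := by ring
      _ ≤ δ / 2 * M + δ / 2 * M + (k * C * (U + F) + 2 * (2 ^ k / ρ) ^ β * (U + F)) := by
          gcongr <;> linarith
      _ = _ := by ring
  · have hα : 0 < β - 1 := sub_pos.mpr hgt
    obtain ⟨a, ha, ha1, haδ⟩ := exists_pos_mul_rpow_le hα one_pos two_pos.le (half_pos hδ)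
    obtain ⟨ρ, hρ, hρ4, C, hC, η, hη, hmain⟩ :=
      exists_abs_sd_le_of_hSemi n hs hβ0 hβ hβ1 hlam hlamLam
        (show 0 < δ * a / 4 by positivity)
    refine ⟨2 * C / a + 4 / (a * ρ ^ β), by positivity, η, hη, ?_⟩
    intro K u f U F M hM hK hell hKant hcs hu hsemi hsol hU hF hbu hbf
    have hsd := hmain K u f F M hM hK hell hKant hcs hu hsemi hsol hbf
    rw [hDeg_eq_one hgt hβ2] at hu
    rw [hSemi_le_ofReal_iff_of_one_lt hgt hβ2 hM.le isOpen_univ] at hsemi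
    rw [hSemi_le_ofReal_iff_of_one_lt hgt hβ2 (by positivity) isOpen_ball]
    intro x hx y hy
    refine (norm_fderiv_sub_le_of_sd hgt hM.le (by positivity) hU hρ hρ4 ha ha1
      (hu.differentiable (by simp))
      (fun x y => hsemi x (mem_univ _) y (mem_univ _)) hsd hbu hx hy).trans ?_
    gcongr ?_ * _
    calc _ = 2 * a ^ (β - 1) * M + δ / 2 * M + (2 * C / a * F + 4 / (a * ρ ^ β) * U) := by
          field_simp
          ring
      _ ≤ δ / 2 * M + δ / 2 * M + (2 * C / a * (U + F) + 4 / (a * ρ ^ β) * (U + F)) := by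
          gcongr <;> linarith
      _ = _ := by ring

theorem abs_le_toReal_supNorm {Ω : Set (Euc n)} {u : Euc n → ℝ} (h : supNorm Ω u ≠ ⊤) {x : Euc n}
    (hx : x ∈ Ω) : |u x| ≤ (supNorm Ω u).toReal := by
  rw [← ENNReal.ofReal_le_iff_le_toReal h]
  exact le_iSup (fun x : Ω => ENNReal.ofReal |u x|) ⟨x, hx⟩

/-- **Interpolation-type a priori estimate in non-divergence form** (Proposition 6.3).
For any `δ > 0` there are `C_δ` and `η_δ > 0`, depending only on `δ, n, s, β, λ, Λ`, such
that for any uniformly elliptic family of symmetric Lévy kernels with Kantorovich-oscillation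
at most `η_δ`,
`[u]_{C^β(B_{1/2})} ≤ δ [u]_{C^β(ℝⁿ)} + C_δ (‖u‖_{L^∞(B₁)} + ‖f‖_{L^∞(B₁)})`
for any compactly supported `u ∈ C^{2s+ε'}(ℝⁿ)` (some `ε' > 0`) solving `L(u,x) = f`
pointwise in `B₁`. -/
theorem stmt13 (n : ℕ) (s β lam Lam : ℝ)
    (hs : s ∈ Set.Ioo (0 : ℝ) 1) (hβ : β ∈ Set.Ioo 0 (2 * s)) (hβ1 : β ≠ 1)
    (hlam : 0 < lam) (hlamLam : lam ≤ Lam) :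
    ∀ δ > (0 : ℝ), ∃ Cδ > (0 : ℝ), ∃ ηδ > (0 : ℝ),
      ∀ (K : Euc n → Measure (Euc n)) (u f : Euc n → ℝ),
        (∀ x, IsLevyMeasure (K x)) →
        (∀ x, UnifElliptic s lam Lam (K x)) →
        (∀ x x' : Euc n, KantCond s β (K x) (K x') ηδ) →
        HasCompactSupport u →
        (∃ ε' > (0 : ℝ), HolderMem (2 * s + ε') Set.univ u) →
        SolvesPtwise K u f (ball 0 1) →
        hSemi β (ball 0 (1 / 2)) u ≤
          ENNReal.ofReal δ * hSemi β Set.univ u +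
            ENNReal.ofReal Cδ * (supNorm (ball 0 1) u + supNorm (ball 0 1) f) := by
  intro δ hδ
  obtain ⟨C, hC, η, hη, hmain⟩ :=
    exists_hSemi_le n hs.2 hβ.1 hβ.2 hβ1 hlam hlamLam hδ
  refine ⟨C, hC, η, hη, ?_⟩
  intro K u f hK hell hKant hcs hreg hsol
  obtain ⟨ε', hε', hreg, -⟩ := hreg
  have hu : ContDiff ℝ (hDeg β) u :=
    (contDiffOn_univ.mp hreg).of_le
      (by exact_mod_cast hDeg_mono (by linarith [hβ.2] : β ≤ 2 * s + ε'))
  by_cases hm : hSemi β univ u = ⊤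
  · simp [hm, ENNReal.mul_top, hδ]
  by_cases hU : supNorm (ball 0 1) u = ⊤
  · simp [hU, ENNReal.mul_top, hC]
  by_cases hF : supNorm (ball 0 1) f = ⊤
  · simp [hF, ENNReal.mul_top, hC]
  refine ENNReal.le_of_forall_pos_le_add fun κ hκ _ => ?_
  have hκ' : (0 : ℝ) < κ / δ := by positivity
  set m := (hSemi β univ u).toReal with hm_def
  set U := (supNorm (ball 0 1) u).toReal with hU_def
  set F := (supNorm (ball 0 1) f).toReal with hF_def
  have hm0 : 0 ≤ m := ENNReal.toReal_nonneg
  have hU0 : 0 ≤ U := ENNReal.toReal_nonneg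
  have hF0 : 0 ≤ F := ENNReal.toReal_nonneg
  have hle : hSemi β univ u ≤ ENNReal.ofReal (m + κ / δ) :=
    (ENNReal.ofReal_toReal hm).symm.le.trans (ENNReal.ofReal_le_ofReal (by linarith))
  refine (hmain K u f U F (m + κ / δ) (by positivity) hK hell hKant hcs hu hle hsol hU0 hF0
    (fun x hx => abs_le_toReal_supNorm hU hx) (fun x hx => abs_le_toReal_supNorm hF hx)).trans ?_
  rw [← ENNReal.ofReal_toReal hm, ← ENNReal.ofReal_toReal hU, ← ENNReal.ofReal_toReal hF,
    ← hm_def, ← hU_def, ← hF_def, ← ENNReal.ofReal_add hU0 hF0, ← ENNReal.ofReal_mul hδ.le,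
    ← ENNReal.ofReal_mul hC.le, ← ENNReal.ofReal_add (by positivity) (by positivity),
    ← ENNReal.ofReal_coe_nnreal, ← ENNReal.ofReal_add (by positivity) (by positivity)]
  refine ENNReal.ofReal_le_ofReal (le_of_eq ?_)
  field_simp
  ring

end
end

section
/- Functions with constant iterated incremental quotients are polynomials (Appendix Lemma A.1(i)). Let m ≥ 1 and let f ∈ C^{m−1}(ℝⁿ). For h ∈ ℝⁿ∖{0} define D_h f(x) := (f(x+h) − f(x))/|h| and D_h^m f := D_h(D_h^{m−1} f). If for every h ∈ ℝⁿ∖{0} the function x ↦ D_h^m f(x) is constant on ℝⁿ (the constant may depend on h), then f is a polynomial of degree at most m. -/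
noncomputable section

/-- First-order incremental quotient `D_h f (x) = (f(x+h) - f(x))/|h|`. -/
def incQuot {n : ℕ} (h : EuclideanSpace ℝ (Fin n)) (f : EuclideanSpace ℝ (Fin n) → ℝ) :
    EuclideanSpace ℝ (Fin n) → ℝ :=
  fun x => (f (x + h) - f x) / ‖h‖

open scoped Polynomial in
/-- A continuous function of a real variable whose forward differences of order `m + 1` all vanish
is, on `[0, ∞)`, a polynomial of degree at most `m`. -/
theorem exists_polynomial_of_fwdDiff_iter_eq_zero_of_nonneg {g : ℝ → ℝ} (hg : Continuous g) {m : ℕ}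
    (h : ∀ s t, (fwdDiff s)^[m + 1] g t = 0) :
    ∃ P : ℝ[X], P.natDegree ≤ m ∧ ∀ t, 0 ≤ t → g t = P.eval t := by
  have key : ∀ N : ℕ, 0 < N → ∃ P : ℝ[X], P.natDegree ≤ m ∧
      ∀ k : ℕ, g (k / N) = P.eval ((k : ℝ) / N) := by
    intro N hN
    have hN' : (N : ℝ) ≠ 0 := by positivity
    set s : ℝ := 1 / N with hs
    refine ⟨∑ i ∈ Finset.range (m + 1), Polynomial.C ((fwdDiff s)^[i] g 0 / (i.factorial : ℝ)) *
      (descPochhammer ℝ i).comp (Polynomial.C (N : ℝ) * Polynomial.X), ?_, fun k => ?_⟩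
    · refine Polynomial.natDegree_sum_le_of_forall_le _ _ fun i hi => ?_
      refine (Polynomial.natDegree_C_mul_le _ _).trans ?_
      refine Polynomial.natDegree_comp_le.trans ?_
      rw [descPochhammer_natDegree, Polynomial.natDegree_C_mul_X _ hN', mul_one]
      exact Nat.lt_succ_iff.mp (Finset.mem_range.mp hi)
    · have hz : ∀ i, m + 1 ≤ i → (fwdDiff s)^[i] g 0 = 0 := by
        intro i hi
        obtain ⟨j, rfl⟩ := Nat.exists_eq_add_of_le' hi
        rw [Function.iterate_add_apply, show (fwdDiff s)^[m + 1] g = fun _ => 0 from funext (h s)]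
        clear hi
        induction j with
        | zero => rfl
        | succ j ih => rw [Function.iterate_succ_apply, fwdDiff_const]; exact ih
      have e := shift_eq_sum_fwdDiff_iter s g k 0
      have e1 : (0 : ℝ) + k • s = k / N := by simp [hs, div_eq_mul_inv]
      rw [e1] at e
      rw [e, Polynomial.eval_finsetSum]
      have hterm : ∀ i, Polynomial.eval ((k : ℝ) / N)
          (Polynomial.C ((fwdDiff s)^[i] g 0 / (i.factorial : ℝ)) *
          (descPochhammer ℝ i).comp (Polynomial.C (N : ℝ) * Polynomial.X)) =
          k.choose i • (fwdDiff s)^[i] g 0 := by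
        intro i
        have hf : (i.factorial : ℝ) ≠ 0 := by positivity
        rw [Polynomial.eval_mul, Polynomial.eval_C, Polynomial.eval_comp, Polynomial.eval_mul,
          Polynomial.eval_C, Polynomial.eval_X, mul_div_cancel₀ _ hN',
          descPochhammer_eval_eq_descFactorial, Nat.descFactorial_eq_factorial_mul_choose,
          nsmul_eq_mul]
        push_cast
        field_simp
      rw [Finset.sum_congr rfl fun i _ => hterm i]
      rcases le_total k m with hkm | hkm
      · refine Finset.sum_subset (Finset.range_mono (by omega)) fun i _ hi => ?_
        rw [Nat.choose_eq_zero_of_lt (by simpa using hi), zero_smul]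
      · refine (Finset.sum_subset (Finset.range_mono (by omega)) fun i _ hi => ?_).symm
        rw [hz i (by simpa using hi), smul_zero]
  obtain ⟨P, hPd, hP⟩ := key 1 one_pos
  refine ⟨P, hPd, fun t ht => ?_⟩
  have hrat : ∀ N : ℕ, 0 < N → ∀ k : ℕ, g (k / N) = P.eval ((k : ℝ) / N) := by
    intro N hN k
    obtain ⟨Q, -, hQ⟩ := key N hN
    have hN' : (N : ℝ) ≠ 0 := by positivity
    have : P = Q := by
      refine Polynomial.eq_of_infinite_eval_eq P Q
        ((Set.infinite_range_of_injective (Nat.cast_injective (R := ℝ))).mono ?_)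
      rintro _ ⟨j, rfl⟩
      have h1 := hP j
      have h2 := hQ (j * N)
      simp only [Nat.cast_one, div_one] at h1
      rw [Nat.cast_mul, mul_div_cancel_right₀ _ hN'] at h2
      exact h1.symm.trans h2
    rw [this, hQ]
  have hlim : Filter.Tendsto (fun N : ℕ => (⌊t * (N : ℝ)⌋₊ : ℝ) / N) Filter.atTop (nhds t) :=
    (tendsto_nat_floor_mul_div_atTop ht).comp tendsto_natCast_atTop_atTop
  refine tendsto_nhds_unique ((hg.tendsto t).comp hlim)
    (((P.continuous.tendsto t).comp hlim).congr' ?_)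
  filter_upwards [Filter.eventually_gt_atTop 0] with N hN
  exact (hrat N hN _).symm

theorem fwdDiff_iter_comp_line {E : Type*} [AddCommGroup E] [Module ℝ E] (f : E → ℝ) (x v : E)
    (s : ℝ) (k : ℕ) (t : ℝ) :
    (fwdDiff s)^[k] (fun t : ℝ => f (x + t • v)) t = (fwdDiff (s • v))^[k] f (x + t • v) := by
  induction k generalizing t with
  | zero => rfl
  | succ k ih =>
    simp only [Function.iterate_succ_apply', fwdDiff, ih, add_smul, add_assoc]

open scoped Polynomial in
/-- Fréchet's theorem: a continuous function of a real variable whose forward differences of order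
`m + 1` all vanish is a polynomial of degree at most `m`. -/
theorem exists_polynomial_of_fwdDiff_iter_eq_zero {g : ℝ → ℝ} (hg : Continuous g) {m : ℕ}
    (h : ∀ s t, (fwdDiff s)^[m + 1] g t = 0) :
    ∃ P : ℝ[X], P.natDegree ≤ m ∧ ∀ t, g t = P.eval t := by
  obtain ⟨P, hPd, hP⟩ := exists_polynomial_of_fwdDiff_iter_eq_zero_of_nonneg hg h
  refine ⟨P, hPd, fun x => ?_⟩
  have hg' : Continuous fun t : ℝ => g (-|x| + t • (1 : ℝ)) := by fun_prop
  obtain ⟨Q, -, hQ⟩ := exists_polynomial_of_fwdDiff_iter_eq_zero_of_nonneg hg' (m := m)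
    fun s t => by rw [fwdDiff_iter_comp_line]; exact h _ _
  have hPQ : P.comp (Polynomial.X - Polynomial.C |x|) = Q := by
    refine Polynomial.eq_of_infinite_eval_eq _ _ ((Set.Ici_infinite |x|).mono fun t ht => ?_)
    have ht' : |x| ≤ t := ht
    have h1 := hP (t - |x|) (by linarith)
    have h2 := hQ t ((abs_nonneg x).trans ht')
    have e : -|x| + t • (1 : ℝ) = t - |x| := by simp; ring
    rw [e, h1] at h2
    simpa using h2
  have h3 := hQ (x + |x|) (by linarith [neg_abs_le x])
  rw [← hPQ] at h3
  simpa using h3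

/-- A function that is a polynomial of degree at most `m` in each variable separately is a
polynomial. -/
theorem exists_mvPolynomial_of_update {σ : Type*} [Fintype σ] [DecidableEq σ] {f : (σ → ℝ) → ℝ}
    {m : ℕ} (h : ∀ x i, ∃ P : Polynomial ℝ, P.natDegree ≤ m ∧
      ∀ t, f (Function.update x i t) = P.eval t) :
    ∃ p : MvPolynomial σ ℝ, ∀ x, f x = MvPolynomial.eval x p := by
  suffices H : ∀ (S : Finset σ) (a : σ → ℝ), ∃ p : MvPolynomial σ ℝ,
      ∀ x, f (S.piecewise x a) = MvPolynomial.eval x p by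
    obtain ⟨p, hp⟩ := H Finset.univ 0
    exact ⟨p, fun x => by rw [← hp x, Finset.piecewise_univ]⟩
  intro S
  induction S using Finset.induction_on with
  | empty => exact fun a => ⟨MvPolynomial.C (f a), fun x => by simp⟩
  | insert i S hi ih =>
    intro a
    choose q hq using fun k : ℕ => ih (Function.update a i k)
    have hinj : Set.InjOn (fun k : ℕ => (k : ℝ)) (Finset.range (m + 1)) :=
      Nat.cast_injective.injOn
    refine ⟨∑ k ∈ Finset.range (m + 1), q k * Polynomial.aeval (MvPolynomial.X i)
      (Lagrange.basis (Finset.range (m + 1)) (fun k : ℕ => (k : ℝ)) k), fun x => ?_⟩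
    obtain ⟨P, hPd, hP⟩ := h (S.piecewise x a) i
    have hP' := Lagrange.eq_interpolate (f := P) hinj (by
      rw [Finset.card_range]
      exact (Polynomial.degree_le_of_natDegree_le hPd).trans_lt
        (by exact_mod_cast Nat.lt_succ_self m))
    rw [Finset.piecewise_insert, hP, hP', Lagrange.interpolate_apply, Polynomial.eval_finsetSum,
      map_sum]
    refine Finset.sum_congr rfl fun k _ => ?_
    rw [Polynomial.eval_mul, Polynomial.eval_C, map_mul, ← hq, ← hP,
      Finset.update_piecewise_of_notMem _ _ _ hi]
    congr 1
    rw [← MvPolynomial.coe_aeval_eq_eval, RingHom.coe_coe, ← Polynomial.aeval_algHom_apply,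
      MvPolynomial.aeval_X, Polynomial.coe_aeval_eq_eval]

theorem MvPolynomial.IsHomogeneous.eval_smul {σ R : Type*} [CommSemiring R] {p : MvPolynomial σ R}
    {j : ℕ} (hp : p.IsHomogeneous j) (x : σ → R) (t : R) :
    eval (t • x) p = t ^ j * eval x p := by
  rw [eval_eq, eval_eq, Finset.mul_sum]
  refine Finset.sum_congr rfl fun d hd => ?_
  have hdj : ∑ i ∈ d.support, d i = j := by
    simpa [Finsupp.weight_apply, Finsupp.sum] using hp (mem_support_iff.mp hd)
  simp only [Pi.smul_apply, smul_eq_mul, mul_pow, Finset.prod_mul_distrib,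
    Finset.prod_pow_eq_pow_sum, hdj]
  ring

/-- A polynomial function whose restriction to each line through the origin has degree at most `m`
is given by a polynomial of total degree at most `m`. -/
theorem MvPolynomial.exists_totalDegree_le_of_eval_smul {σ : Type*} (p : MvPolynomial σ ℝ) {m : ℕ}
    (h : ∀ x : σ → ℝ, ∃ P : Polynomial ℝ, P.natDegree ≤ m ∧
      ∀ t : ℝ, MvPolynomial.eval (t • x) p = P.eval t) :
    ∃ q : MvPolynomial σ ℝ, q.totalDegree ≤ m ∧
      ∀ x, MvPolynomial.eval x p = MvPolynomial.eval x q := by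
  refine ⟨∑ j ∈ Finset.range (m + 1), homogeneousComponent j p, ?_, fun x => ?_⟩
  · refine totalDegree_finsetSum_le fun j hj => ?_
    exact (homogeneousComponent_isHomogeneous j p).totalDegree_le.trans
      (Nat.lt_succ_iff.mp (Finset.mem_range.mp hj))
  · obtain ⟨P, hPd, hP⟩ := h x
    have hR : P = ∑ j ∈ Finset.range (p.totalDegree + 1),
        Polynomial.monomial j (eval x (homogeneousComponent j p)) := by
      refine Polynomial.funext fun t => ?_
      rw [← hP t]
      conv_lhs => rw [← sum_homogeneousComponent p]
      rw [map_sum, Polynomial.eval_finsetSum]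
      refine Finset.sum_congr rfl fun j _ => ?_
      rw [Polynomial.eval_monomial, mul_comm]
      exact (homogeneousComponent_isHomogeneous j p).eval_smul x t
    have hcoeff : ∀ j, P.coeff j = eval x (homogeneousComponent j p) := by
      intro j
      rw [hR, Polynomial.finsetSum_coeff]
      simp only [Polynomial.coeff_monomial, Finset.sum_ite_eq', Finset.mem_range]
      split_ifs with hj
      · rfl
      · rw [homogeneousComponent_eq_zero _ _ (by omega), map_zero]
    have h1 := hP 1
    rw [one_smul, Polynomial.eval_eq_sum_range' (Nat.lt_succ_iff.mpr hPd)] at h1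
    simpa [hcoeff] using h1

theorem incQuot_iterate_apply {n : ℕ} (h : EuclideanSpace ℝ (Fin n))
    (f : EuclideanSpace ℝ (Fin n) → ℝ) (k : ℕ) (x : EuclideanSpace ℝ (Fin n)) :
    (incQuot h)^[k] f x = (fwdDiff h)^[k] f x / ‖h‖ ^ k := by
  induction k generalizing x with
  | zero => simp
  | succ k ih =>
    simp only [Function.iterate_succ_apply', incQuot, fwdDiff, ih]
    rw [pow_succ, ← sub_div, div_div]

/-- **Functions with constant iterated incremental quotients are polynomials**
(Appendix Lemma A.1(i)). If `f ∈ C^{m-1}(ℝⁿ)` and, for every `h ≠ 0`, the `m`-th iterated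
incremental quotient `D_h^m f` is constant on `ℝⁿ`, then `f` is a polynomial of degree at
most `m`. -/
theorem stmt14 (n m : ℕ) (hm : 1 ≤ m) (f : EuclideanSpace ℝ (Fin n) → ℝ)
    (hf : ContDiff ℝ (m - 1 : ℕ) f)
    (hconst : ∀ h : EuclideanSpace ℝ (Fin n), h ≠ 0 →
      ∃ c : ℝ, ∀ x : EuclideanSpace ℝ (Fin n), (incQuot h)^[m] f x = c) :
    ∃ p : MvPolynomial (Fin n) ℝ, p.totalDegree ≤ m ∧
      ∀ x : EuclideanSpace ℝ (Fin n), f x = MvPolynomial.eval (fun i => x i) p := by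
  have hzero : ∀ h x : EuclideanSpace ℝ (Fin n), (fwdDiff h)^[m + 1] f x = 0 := by
    intro h x
    rw [Function.iterate_succ_apply']
    rcases eq_or_ne h 0 with rfl | hh
    · simp [fwdDiff]
    · obtain ⟨c, hc⟩ := hconst h hh
      have hn : ‖h‖ ^ m ≠ 0 := pow_ne_zero _ (norm_ne_zero_iff.mpr hh)
      have hd : ∀ y, (fwdDiff h)^[m] f y = c * ‖h‖ ^ m := fun y =>
        (div_eq_iff hn).mp ((incQuot_iterate_apply h f m y).symm.trans (hc y))
      rw [fwdDiff, hd, hd, sub_self]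
  have hline : ∀ x v : EuclideanSpace ℝ (Fin n), ∃ P : Polynomial ℝ, P.natDegree ≤ m ∧
      ∀ t : ℝ, f (x + t • v) = P.eval t := by
    intro x v
    have hc : Continuous fun t : ℝ => f (x + t • v) := hf.continuous.comp (by fun_prop)
    exact exists_polynomial_of_fwdDiff_iter_eq_zero hc fun s t => by
      rw [fwdDiff_iter_comp_line, hzero]
  obtain ⟨p, hp⟩ := exists_mvPolynomial_of_update (f := fun x => f (WithLp.toLp 2 x)) (m := m) (by
    intro x i
    obtain ⟨P, hPd, hP⟩ := hline (WithLp.toLp 2 (Function.update x i 0)) (EuclideanSpace.single i 1)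
    refine ⟨P, hPd, fun t => ?_⟩
    rw [← hP t]
    congr 1
    ext j
    rcases eq_or_ne j i with rfl | hj
    · simp
    · simp [hj])
  obtain ⟨q, hqd, hq⟩ := p.exists_totalDegree_le_of_eval_smul (m := m) (by
    intro x
    obtain ⟨P, hPd, hP⟩ := hline 0 (WithLp.toLp 2 x)
    exact ⟨P, hPd, fun t => by rw [← hp, ← hP t, zero_add, WithLp.toLp_smul]⟩)
  exact ⟨q, hqd, fun x => (hp fun i => x i).trans (hq _)⟩

end
end
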